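/- arXiv:2106.15933 — 2 statements merged into one kernel-verified Lean document; each statement's English description precedes it below -/
import Mathlib

section
/- Let L ≥ 2 and n₀, n_L be fixed, consider rectangular (L,w)-DLNs, and let θ have i.i.d. N(0, w^{−γ}) entries with γ > 1. Suppose the set of matrices minimizing C is nonempty, has Lebesgue measure zero in ℝ^{n_L×n₀}, and does not contain the zero matrix. Then, as w → ∞, d_m ≍ 1 and d_s ≍ w^{−(γ−1)/2}. -/
open MeasureTheory ProbabilityTheory

noncomputable section

/-- Index set for the parameters of a rectangular `(L,w)`-DLN with input dimension `n0`
and output dimension `nL`: entries of `W₁ ∈ ℝ^{w×n0}`, of the `L-2` hidden matrices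
`W₂,…,W_{L-1} ∈ ℝ^{w×w}`, and of `W_L ∈ ℝ^{nL×w}`. -/
abbrev DLNIdx (n0 nL w L : ℕ) :=
  (Fin w × Fin n0) ⊕ (Fin (L - 2) × Fin w × Fin w) ⊕ (Fin nL × Fin w)

/-- The (Euclidean) parameter space of a rectangular `(L,w)`-DLN, as a plain pi type. -/
abbrev DLNParams (n0 nL w L : ℕ) := DLNIdx n0 nL w L → ℝ

variable {n0 nL w L : ℕ}

/-- The first weight matrix `W₁`. -/
def dlnW1 (θ : DLNParams n0 nL w L) : Matrix (Fin w) (Fin n0) ℝ :=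
  Matrix.of fun i j => θ (Sum.inl (i, j))

/-- The hidden weight matrices `W₂, …, W_{L-1}` (`dlnWmid θ ℓ = W_{ℓ+2}`). -/
def dlnWmid (θ : DLNParams n0 nL w L) (ℓ : Fin (L - 2)) : Matrix (Fin w) (Fin w) ℝ :=
  Matrix.of fun i j => θ (Sum.inr (Sum.inl (ℓ, i, j)))

/-- The last weight matrix `W_L`. -/
def dlnWL (θ : DLNParams n0 nL w L) : Matrix (Fin nL) (Fin w) ℝ :=
  Matrix.of fun i j => θ (Sum.inr (Sum.inr (i, j)))

/-- The matrix `A_θ = W_L ⋯ W₁` realized by the network, as a function. -/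
def dlnMatrix (θ : DLNParams n0 nL w L) : Fin nL → Fin n0 → ℝ :=
  fun i j => (dlnWL θ * (List.ofFn (dlnWmid θ)).reverse.prod * dlnW1 θ) i j

/-- The loss `𝓛(θ) = C(A_θ)`. -/
def dlnLoss (C : (Fin nL → Fin n0 → ℝ) → ℝ) (θ : DLNParams n0 nL w L) : ℝ :=
  C (dlnMatrix θ)

/-- Euclidean distance between two parameter vectors. -/
def dlnDist (θ θ' : DLNParams n0 nL w L) : ℝ :=
  Real.sqrt (∑ i, (θ i - θ' i) ^ 2)

/-- `θ` is a global minimum of `𝓛`, i.e. `C (A_θ) = inf C`. -/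
def DLNIsGlobalMin (C : (Fin nL → Fin n0 → ℝ) → ℝ) (θ : DLNParams n0 nL w L) : Prop :=
  ∀ A, C (dlnMatrix θ) ≤ C A

/-- `θ` is a saddle of `𝓛`: a critical point at which `𝓛` has no local minimum. -/
def DLNIsSaddle (C : (Fin nL → Fin n0 → ℝ) → ℝ) (θ : DLNParams n0 nL w L) : Prop :=
  fderiv ℝ (dlnLoss C) θ = 0 ∧ ¬ IsLocalMin (dlnLoss C) θ

/-- `d_m`: Euclidean distance from `θ` to the set of global minima of `𝓛`. -/
def dlnDm (C : (Fin nL → Fin n0 → ℝ) → ℝ) (θ : DLNParams n0 nL w L) : ℝ :=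
  sInf ((fun θ' => dlnDist θ θ') '' {θ' | DLNIsGlobalMin C θ'})

/-- `d_s`: Euclidean distance from `θ` to the set of saddles of `𝓛`. -/
def dlnDs (C : (Fin nL → Fin n0 → ℝ) → ℝ) (θ : DLNParams n0 nL w L) : ℝ :=
  sInf ((fun θ' => dlnDist θ θ') '' {θ' | DLNIsSaddle C θ'})

/-- The law of a parameter vector with i.i.d. centered Gaussian `N(0, σ²)` entries. -/
def dlnGauss (n0 nL w L : ℕ) (σ2 : ℝ) : Measure (DLNParams n0 nL w L) :=
  Measure.pi fun _ => gaussianReal 0 (Real.toNNReal σ2)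

/-- i.i.d. centred Gaussian product measure. -/
abbrev gPi (ι : Type) [Fintype ι] (v : NNReal) : Measure (ι → ℝ) :=
  Measure.pi fun _ => gaussianReal 0 v

theorem gPi_mgf_integrable {ι : Type} [Fintype ι] (v : NNReal) (c : ι → ℝ) :
    Integrable (fun x : ι → ℝ => Real.exp (∑ i, c i * x i)) (gPi ι v) := by
  simp_rw [Real.exp_sum]
  exact Integrable.fintype_prod (fun i => integrable_exp_mul_gaussianReal (c i))

theorem gPi_mgf {ι : Type} [Fintype ι] (v : NNReal) (c : ι → ℝ) :
    ∫ x, Real.exp (∑ i, c i * x i) ∂(gPi ι v) = Real.exp (v * (∑ i, c i ^ 2) / 2) := by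
  simp_rw [Real.exp_sum]
  rw [integral_fintype_prod_eq_prod (fun i x => Real.exp (c i * x))]
  have : ∀ i, ∫ x, Real.exp (c i * x) ∂(gaussianReal 0 v) = Real.exp (v * c i ^ 2 / 2) := by
    intro i
    have := congrFun (mgf_fun_id_gaussianReal (μ := 0) (v := v)) (c i)
    simpa [mgf] using this
  simp_rw [this, ← Real.exp_sum]
  congr 1
  rw [Finset.mul_sum, Finset.sum_div]

theorem gPi_mgf_lintegral {ι : Type} [Fintype ι] (v : NNReal) (c : ι → ℝ) :
    ∫⁻ x, ENNReal.ofReal (Real.exp (∑ i, c i * x i)) ∂(gPi ι v)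
      = ENNReal.ofReal (Real.exp (v * (∑ i, c i ^ 2) / 2)) := by
  rw [← gPi_mgf, ofReal_integral_eq_lintegral_ofReal (gPi_mgf_integrable v c)]
  exact Filter.Eventually.of_forall fun x => (Real.exp_pos _).le

theorem gPi_memLp {ι : Type} [Fintype ι] (v : NNReal) (c : ι → ℝ) (p : NNReal) :
    MemLp (fun x : ι → ℝ => ∑ i, c i * x i) p (gPi ι v) := by
  apply memLp_finsetSum
  intro i _
  apply MemLp.const_mul
  exact (memLp_id_gaussianReal (μ := 0) (v := v) p).comp_measurePreserving
    (measurePreserving_eval (fun _ : ι => gaussianReal 0 v) i)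

theorem pow_four_le_cosh (x : ℝ) : x ^ 4 ≤ 24 * (Real.exp x + Real.exp (-x)) := by
  have h : ∀ y : ℝ, 0 ≤ y → y ^ 4 ≤ 24 * Real.exp y := by
    intro y hy
    have := Real.pow_div_factorial_le_exp y hy 4
    have h4 : (Nat.factorial 4 : ℝ) = 24 := by norm_num [Nat.factorial]
    rw [h4] at this
    linarith
  rcases le_total 0 x with hx | hx
  · have := h x hx
    nlinarith [Real.exp_pos (-x)]
  · have := h (-x) (by linarith)
    have e : (-x) ^ 4 = x ^ 4 := by ring
    rw [e] at this
    nlinarith [Real.exp_pos x]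

theorem gPi_fourth {ι : Type} [Fintype ι] (v : NNReal) (c : ι → ℝ) :
    ∫ x, (∑ i, c i * x i) ^ 4 ∂(gPi ι v) ≤ 96 * ((v : ℝ) * ∑ i, c i ^ 2) ^ 2 := by
  set S : ℝ := (v : ℝ) * ∑ i, c i ^ 2 with hS
  have hS0 : 0 ≤ S := by positivity
  have key : ∀ t : ℝ, t ^ 4 * ∫ x, (∑ i, c i * x i) ^ 4 ∂(gPi ι v)
      ≤ 48 * Real.exp (t ^ 2 * S / 2) := by
    intro t
    have i1 := gPi_mgf_integrable v (fun i => t * c i)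
    have i2 := gPi_mgf_integrable v (fun i => -(t * c i))
    have e1 := gPi_mgf v (fun i => t * c i)
    have e2 := gPi_mgf v (fun i => -(t * c i))
    have s1 : (v : ℝ) * (∑ i, (t * c i) ^ 2) / 2 = t ^ 2 * S / 2 := by
      simp_rw [mul_pow, ← Finset.mul_sum, hS]; ring
    have s2 : (v : ℝ) * (∑ i, (-(t * c i)) ^ 2) / 2 = t ^ 2 * S / 2 := by
      simp_rw [neg_sq, mul_pow, ← Finset.mul_sum, hS]; ring
    rw [s1] at e1
    rw [s2] at e2
    have : ∫ x, (t ^ 4 * (∑ i, c i * x i) ^ 4) ∂(gPi ι v) ≤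
        ∫ x, 24 * (Real.exp (∑ i, (t * c i) * x i) + Real.exp (∑ i, (-(t * c i)) * x i))
          ∂(gPi ι v) := by
      apply integral_mono_of_nonneg
      · exact Filter.Eventually.of_forall fun x => by positivity
      · exact (i1.add i2).const_mul 24
      · refine Filter.Eventually.of_forall fun x => ?_
        have := pow_four_le_cosh (t * ∑ i, c i * x i)
        have a1 : t * ∑ i, c i * x i = ∑ i, (t * c i) * x i := by
          rw [Finset.mul_sum]; exact Finset.sum_congr rfl fun _ _ => by ring
        have a2 : -(t * ∑ i, c i * x i) = ∑ i, (-(t * c i)) * x i := by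
          rw [Finset.mul_sum, ← Finset.sum_neg_distrib]
          exact Finset.sum_congr rfl fun _ _ => by ring
        rw [mul_pow, a2, a1] at this
        exact this
    rw [integral_const_mul, integral_const_mul, integral_add i1 i2, e1, e2] at this
    linarith
  have hI0 : 0 ≤ ∫ x, (∑ i, c i * x i) ^ 4 ∂(gPi ι v) :=
    integral_nonneg fun x => by positivity
  set I := ∫ x, (∑ i, c i * x i) ^ 4 ∂(gPi ι v) with hI
  have hexp : Real.exp (1 / 2) ≤ 2 := by
    have := Real.exp_one_lt_d9
    have h2 : Real.exp (1 / 2) * Real.exp (1 / 2) = Real.exp 1 := by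
      rw [← Real.exp_add]; norm_num
    nlinarith [Real.exp_pos (1 / 2 : ℝ)]
  rcases hS0.eq_or_lt with h0 | hpos
  · -- degenerate case
    rw [← h0]
    have hb : ∀ t : ℝ, t ^ 4 * I ≤ 48 := by
      intro t
      have := key t
      rw [← h0] at this
      simpa using this
    by_contra hcon
    have hI1 : 0 < I := by
      have : (96 * (0 : ℝ) ^ 2) = 0 := by norm_num
      rw [this] at hcon
      exact not_le.mp hcon
    have h1 := hb (1 + 49 / I)
    have h2 : 1 ≤ 1 + 49 / I := by
      have : 0 < 49 / I := by positivity
      linarith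
    have h3 : (1 + 49 / I) ≤ (1 + 49 / I) ^ 4 := by
      exact le_self_pow₀ h2 (by norm_num)
    have h4 : (1 + 49 / I) * I ≤ (1 + 49 / I) ^ 4 * I := by gcongr
    have h5 : (1 + 49 / I) * I = I + 49 := by field_simp
    linarith
  · have := key (Real.sqrt (1 / S))
    have t2 : Real.sqrt (1 / S) ^ 2 = 1 / S := Real.sq_sqrt (by positivity)
    have t4 : Real.sqrt (1 / S) ^ 4 = 1 / S ^ 2 := by
      have : Real.sqrt (1 / S) ^ 4 = (Real.sqrt (1 / S) ^ 2) ^ 2 := by ring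
      rw [this, t2]; field_simp
    rw [t2, t4] at this
    have e : 1 / S * S / 2 = 1 / 2 := by field_simp
    rw [e, div_mul_eq_mul_div, one_mul, div_le_iff₀ (by positivity)] at this
    nlinarith [sq_nonneg S]

theorem gPi_sq {ι : Type} [Fintype ι] (v : NNReal) (c : ι → ℝ) :
    ∫ x, (∑ i, c i * x i) ^ 2 ∂(gPi ι v) = (v : ℝ) * ∑ i, c i ^ 2 := by
  have h1 := variance_sum_pi (μ := fun _ : ι => gaussianReal 0 v)
    (X := fun i x => c i * x)
    (fun i => (memLp_id_gaussianReal (μ := 0) (v := v) 2).const_mul (c i))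
  have h2 : ∀ i, Var[fun x => c i * x; gaussianReal 0 v] = c i ^ 2 * v := by
    intro i
    rw [variance_const_mul, variance_fun_id_gaussianReal]
  simp_rw [h2] at h1
  have h3 : (∑ i, fun ω : ι → ℝ => c i * ω i) = fun ω => ∑ i, c i * ω i := by
    ext ω; simp
  rw [h3, variance_eq_sub (gPi_memLp v c 2)] at h1
  have h4 : ∫ x, (∑ i, c i * x i) ∂(gPi ι v) = 0 := by
    rw [integral_finsetSum]
    · apply Finset.sum_eq_zero
      intro i _
      rw [integral_const_mul]
      have : ∫ x : ι → ℝ, x i ∂(gPi ι v) = ∫ y, y ∂(gaussianReal 0 v) := by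
        have hm := measurePreserving_eval (fun _ : ι => gaussianReal 0 v) i
        have := integral_map (μ := gPi ι v) (φ := Function.eval i) (f := fun y : ℝ => y)
          hm.measurable.aemeasurable (by fun_prop)
        rw [hm.map_eq] at this
        exact this.symm
      rw [this]
      simp
    · intro i _
      apply Integrable.const_mul
      have := (memLp_id_gaussianReal (μ := 0) (v := v) 1).comp_measurePreserving
        (measurePreserving_eval (fun _ : ι => gaussianReal 0 v) i)
      exact memLp_one_iff_integrable.mp this
  rw [h4] at h1
  simp only [Pi.pow_apply, ne_eq, OfNat.ofNat_ne_zero, not_false_eq_true, zero_pow, sub_zero] at h1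
  rw [h1, Finset.mul_sum]
  exact Finset.sum_congr rfl fun _ _ => by ring

theorem gPi_integrable_mul {ι : Type} [Fintype ι] (v : NNReal) (c d : ι → ℝ) :
    MemLp (fun x : ι → ℝ => (∑ i, c i * x i) * (∑ i, d i * x i)) 2 (gPi ι v) := by
  have h : ENNReal.HolderTriple 4 4 2 := by
    constructor
    rw [← two_mul, show (4 : ENNReal) = 2 * 2 by norm_num,
      ENNReal.mul_inv (by norm_num) (by norm_num), ← mul_assoc,
      ENNReal.mul_inv_cancel (by norm_num) (by norm_num), one_mul]
  have h1 : MemLp (fun x : ι → ℝ => ∑ i, c i * x i) 4 (gPi ι v) := gPi_memLp v c 4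
  have h2 : MemLp (fun x : ι → ℝ => ∑ i, d i * x i) 4 (gPi ι v) := gPi_memLp v d 4
  exact h2.mul' h1

theorem gPi_cov {ι : Type} [Fintype ι] (v : NNReal) (c d : ι → ℝ) :
    ∫ x, (∑ i, c i * x i) * (∑ i, d i * x i) ∂(gPi ι v) = (v : ℝ) * ∑ i, c i * d i := by
  have h1 := gPi_sq v (fun i => c i + d i)
  have h2 := gPi_sq v (fun i => c i - d i)
  have i1 : Integrable (fun x : ι → ℝ => (∑ i, (c i + d i) * x i) ^ 2) (gPi ι v) :=
    (gPi_memLp v _ 2).integrable_sq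
  have i2 : Integrable (fun x : ι → ℝ => (∑ i, (c i - d i) * x i) ^ 2) (gPi ι v) :=
    (gPi_memLp v _ 2).integrable_sq
  have e : ∀ x : ι → ℝ, (∑ i, c i * x i) * (∑ i, d i * x i)
      = (1 / 4) * ((∑ i, (c i + d i) * x i) ^ 2 - (∑ i, (c i - d i) * x i) ^ 2) := by
    intro x
    simp_rw [add_mul, sub_mul, Finset.sum_add_distrib, Finset.sum_sub_distrib]
    ring
  simp_rw [e]
  rw [integral_const_mul, integral_sub i1 i2, h1, h2, ← mul_sub, ← Finset.sum_sub_distrib,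
    Finset.mul_sum, Finset.mul_sum, Finset.mul_sum]
  exact Finset.sum_congr rfl fun _ _ => by ring

theorem gPi_curry (ι κ : Type) [Fintype ι] [Fintype κ] (v : NNReal) :
    MeasurePreserving (MeasurableEquiv.curry ι κ ℝ) (gPi (ι × κ) v)
      (Measure.pi fun _ : ι => gPi κ v) := by
  refine ⟨(MeasurableEquiv.curry ι κ ℝ).measurable, ?_⟩
  have := Measure.infinitePi_map_curry (ι := ι) (κ := κ) (fun _ _ => gaussianReal 0 v)
  simpa only [Measure.infinitePi_eq_pi] using this

/-- Second moment of one Gram entry after multiplying by a Gaussian matrix. -/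
theorem gram_entry_bound {ι κ : Type} [Fintype ι] [Fintype κ] (v : NNReal) (c d : κ → ℝ) (s : ℝ) :
    ∫⁻ G, ENNReal.ofReal ((∑ i, (∑ j, G (i, j) * c j) * (∑ j, G (i, j) * d j)
        - Fintype.card ι * v * s) ^ 2) ∂(gPi (ι × κ) v)
      ≤ ENNReal.ofReal ((Fintype.card ι * v) ^ 2 * (∑ j, c j * d j - s) ^ 2
          + Fintype.card ι * v ^ 2 * 48 * ((∑ j, c j * c j) ^ 2 + (∑ j, d j * d j) ^ 2)) := by
  classical
  set X : (κ → ℝ) → ℝ := fun x => (∑ i, c i * x i) * (∑ i, d i * x i) with hX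
  set n : ℝ := (Fintype.card ι : ℝ) with hn
  set Y : (ι → κ → ℝ) → ℝ := fun ω => ∑ i, X (ω i) with hY
  have hX2 : MemLp X 2 (gPi κ v) := gPi_integrable_mul v c d
  have hXi : ∀ i : ι, MemLp (fun ω : ι → κ → ℝ => X (ω i)) 2 (Measure.pi fun _ : ι => gPi κ v) :=
    fun i => hX2.comp_measurePreserving (measurePreserving_eval (fun _ : ι => gPi κ v) i)
  have hY2 : MemLp Y 2 (Measure.pi fun _ : ι => gPi κ v) := memLp_finsetSum _ fun i _ => hXi i
  have hvar : Var[Y; Measure.pi fun _ : ι => gPi κ v] = n * Var[X; gPi κ v] := by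
    have h := variance_sum_pi (μ := fun _ : ι => gPi κ v) (X := fun _ => X) (fun _ => hX2)
    have h3 : (∑ i, fun ω : ι → κ → ℝ => X (ω i)) = Y := by ext ω; simp [hY]
    rw [h3] at h
    rw [h]; simp [hn]
  have hmean : ∫ ω, Y ω ∂(Measure.pi fun _ : ι => gPi κ v) = n * (v * ∑ j, c j * d j) := by
    rw [hY, integral_finsetSum _ fun i _ => (hXi i).integrable (by norm_num)]
    have : ∀ i : ι, ∫ ω : ι → κ → ℝ, X (ω i) ∂(Measure.pi fun _ : ι => gPi κ v)
        = v * ∑ j, c j * d j := by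
      intro i
      have hm := measurePreserving_eval (fun _ : ι => gPi κ v) i
      have := integral_map (μ := Measure.pi fun _ : ι => gPi κ v) (φ := Function.eval i) (f := X)
          hm.measurable.aemeasurable (by rw [hm.map_eq]; exact hX2.aestronglyMeasurable)
      rw [hm.map_eq] at this
      rw [← gPi_cov]
      exact this.symm
    simp_rw [this]
    simp [hn]
  have hvX : Var[X; gPi κ v] ≤ v ^ 2 * 48 * ((∑ j, c j * c j) ^ 2 + (∑ j, d j * d j) ^ 2) := by
    refine (variance_le_expectation_sq hX2.aestronglyMeasurable).trans ?_
    have ic : ∀ c : κ → ℝ, Integrable (fun x : κ → ℝ => (∑ i, c i * x i) ^ 4) (gPi κ v) := by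
      intro c
      have := (gPi_integrable_mul v c c).integrable_sq
      refine this.congr (Filter.Eventually.of_forall fun x => ?_)
      simp only
      ring
    have fc := gPi_fourth v c
    have fd := gPi_fourth v d
    have : ∫ x, X x ^ 2 ∂(gPi κ v) ≤
        ∫ x, ((1 / 2) * (∑ i, c i * x i) ^ 4 + (1 / 2) * (∑ i, d i * x i) ^ 4) ∂(gPi κ v) := by
      apply integral_mono hX2.integrable_sq (((ic c).const_mul _).add ((ic d).const_mul _))
      intro x
      simp only [hX, Pi.add_apply]
      nlinarith [sq_nonneg ((∑ i, c i * x i) ^ 2 - (∑ i, d i * x i) ^ 2)]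
    rw [integral_add ((ic c).const_mul _) ((ic d).const_mul _), integral_const_mul,
      integral_const_mul] at this
    have e1 : ∑ j, c j * c j = ∑ j, c j ^ 2 := Finset.sum_congr rfl fun _ _ => by ring
    have e2 : ∑ j, d j * d j = ∑ j, d j ^ 2 := Finset.sum_congr rfl fun _ _ => by ring
    rw [e1, e2]
    simp only [Pi.pow_apply]
    nlinarith
  have step : ∫⁻ ω, ENNReal.ofReal ((Y ω - n * v * s) ^ 2) ∂(Measure.pi fun _ : ι => gPi κ v)
      = ENNReal.ofReal (∫ ω, (Y ω - n * v * s) ^ 2 ∂(Measure.pi fun _ : ι => gPi κ v)) := by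
    rw [ofReal_integral_eq_lintegral_ofReal]
    · exact (hY2.sub (memLp_const _)).integrable_sq
    · exact Filter.Eventually.of_forall fun x => sq_nonneg _
  have hL : ∫⁻ G, ENNReal.ofReal ((∑ i, (∑ j, G (i, j) * c j) * (∑ j, G (i, j) * d j)
        - n * v * s) ^ 2) ∂(gPi (ι × κ) v)
      = ∫⁻ ω, ENNReal.ofReal ((Y ω - n * v * s) ^ 2) ∂(Measure.pi fun _ : ι => gPi κ v) := by
    rw [← (gPi_curry ι κ v).lintegral_comp_emb (MeasurableEquiv.measurableEmbedding _)]
    refine lintegral_congr fun G => ?_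
    simp only [hY, hX, MeasurableEquiv.coe_curry, Function.curry_apply]
    simp_rw [mul_comm]
  rw [hL, step]
  apply ENNReal.ofReal_le_ofReal
  have hexp : ∫ ω, (Y ω - n * v * s) ^ 2 ∂(Measure.pi fun _ : ι => gPi κ v)
      = Var[Y; Measure.pi fun _ : ι => gPi κ v] + (n * v * (∑ j, c j * d j - s)) ^ 2 := by
    have h2 := variance_eq_sub (hY2.sub (memLp_const (n * v * s)))
    have h3 : Var[Y - fun _ => n * v * s; Measure.pi fun _ : ι => gPi κ v]
        = Var[Y; Measure.pi fun _ : ι => gPi κ v] := by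
      have := variance_sub_const (X := Y) hY2.aestronglyMeasurable (n * v * s)
      exact this
    rw [h3] at h2
    have h4 : ∫ ω, (Y - fun _ => n * v * s : (ι → κ → ℝ) → ℝ) ω ∂(Measure.pi fun _ : ι => gPi κ v)
        = n * (v * ∑ j, c j * d j) - n * v * s := by
      rw [← hmean]
      simp only [Pi.sub_apply]
      rw [integral_sub (hY2.integrable (by norm_num)) (integrable_const _)]
      simp
    rw [h4] at h2
    simp only [Pi.pow_apply, Pi.sub_apply] at h2
    rw [h2]; ring
  rw [hexp, hvar]
  have hn0 : 0 ≤ n := by positivity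
  nlinarith [mul_le_mul_of_nonneg_left hvX hn0]

/-- Squared Frobenius distance of the Gram matrix from `s • 1`. -/
def gramV {p k : Type} [Fintype p] [Fintype k] [DecidableEq k] (Q : Matrix p k ℝ) (s : ℝ) : ℝ :=
  ∑ a, ∑ b, (∑ i, Q i a * Q i b - if a = b then s else 0) ^ 2

/-- Sum of squares of the diagonal Gram entries. -/
def gramR {p k : Type} [Fintype p] [Fintype k] (Q : Matrix p k ℝ) : ℝ :=
  ∑ a, (∑ i, Q i a * Q i a) ^ 2

/-- Matrix from an uncurried family. -/
def matOf {p q : Type} (G : p × q → ℝ) : Matrix p q ℝ := Matrix.of fun i j => G (i, j)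

theorem gramV_nonneg {p k : Type} [Fintype p] [Fintype k] [DecidableEq k] (Q : Matrix p k ℝ)
    (s : ℝ) : 0 ≤ gramV Q s := by unfold gramV; positivity

theorem gramR_nonneg {p k : Type} [Fintype p] [Fintype k] (Q : Matrix p k ℝ) :
    0 ≤ gramR Q := by unfold gramR; positivity

theorem measurable_gramV {p q k : Type} [Fintype p] [Fintype q] [Fintype k] [DecidableEq k]
    (Q : Matrix q k ℝ) (s : ℝ) :
    Measurable (fun G : p × q → ℝ => gramV (matOf G * Q) s) := by
  unfold gramV matOf
  simp only [Matrix.mul_apply, Matrix.of_apply]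
  fun_prop

theorem measurable_gramR {p q k : Type} [Fintype p] [Fintype q] [Fintype k]
    (Q : Matrix q k ℝ) :
    Measurable (fun G : p × q → ℝ => gramR (matOf G * Q)) := by
  unfold gramR matOf
  simp only [Matrix.mul_apply, Matrix.of_apply]
  fun_prop

theorem gramV_step {p q k : Type} [Fintype p] [Fintype q] [Fintype k] [DecidableEq k]
    (v : NNReal) (Q : Matrix q k ℝ) (s : ℝ) :
    ∫⁻ G, ENNReal.ofReal (gramV (matOf G * Q) (Fintype.card p * v * s)) ∂(gPi (p × q) v)
      ≤ ENNReal.ofReal ((Fintype.card p * v) ^ 2 * gramV Q s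
        + Fintype.card p * v ^ 2 * (96 * Fintype.card k) * gramR Q) := by
  have h := fun a b => gram_entry_bound (ι := p) v (fun j => Q j a) (fun j => Q j b)
    (if a = b then s else 0)
  have e : ∀ G : p × q → ℝ, ENNReal.ofReal (gramV (matOf G * Q) (Fintype.card p * v * s))
      = ∑ a, ∑ b, ENNReal.ofReal ((∑ i, (∑ j, G (i, j) * Q j a) * (∑ j, G (i, j) * Q j b)
        - Fintype.card p * v * (if a = b then s else 0)) ^ 2) := by
    intro G
    unfold gramV matOf
    rw [ENNReal.ofReal_sum_of_nonneg fun a _ => by positivity]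
    refine Finset.sum_congr rfl fun a _ => ?_
    rw [ENNReal.ofReal_sum_of_nonneg fun a _ => by positivity]
    refine Finset.sum_congr rfl fun b _ => ?_
    simp only [Matrix.mul_apply, Matrix.of_apply]
    congr 3
    split_ifs <;> simp
  simp_rw [e]
  rw [lintegral_finsetSum _ fun a _ => by fun_prop]
  have e2 : ∀ a, ∫⁻ G : p × q → ℝ, ∑ b, ENNReal.ofReal
      ((∑ i, (∑ j, G (i, j) * Q j a) * (∑ j, G (i, j) * Q j b)
        - Fintype.card p * v * (if a = b then s else 0)) ^ 2) ∂(gPi (p × q) v)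
      = ∑ b, ∫⁻ G : p × q → ℝ, ENNReal.ofReal
      ((∑ i, (∑ j, G (i, j) * Q j a) * (∑ j, G (i, j) * Q j b)
        - Fintype.card p * v * (if a = b then s else 0)) ^ 2) ∂(gPi (p × q) v) :=
    fun a => lintegral_finsetSum _ fun b _ => by fun_prop
  simp_rw [e2]
  refine (Finset.sum_le_sum fun a _ => Finset.sum_le_sum fun b _ => h a b).trans ?_
  rw [← Finset.sum_congr rfl fun a _ => ENNReal.ofReal_sum_of_nonneg fun b _ => by positivity,
    ← ENNReal.ofReal_sum_of_nonneg fun a _ => by positivity]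
  apply ENNReal.ofReal_le_ofReal
  apply le_of_eq
  simp_rw [Finset.sum_add_distrib, ← Finset.mul_sum, Finset.sum_add_distrib]
  unfold gramV gramR
  simp only [Finset.sum_const, Finset.card_univ, nsmul_eq_mul, ← Finset.mul_sum]
  ring

theorem gramR_step {p q k : Type} [Fintype p] [Fintype q] [Fintype k]
    (v : NNReal) (Q : Matrix q k ℝ) :
    ∫⁻ G, ENNReal.ofReal (gramR (matOf G * Q)) ∂(gPi (p × q) v)
      ≤ ENNReal.ofReal (97 * (Fintype.card p * v) ^ 2 * gramR Q) := by
  have h := fun a => gram_entry_bound (ι := p) v (fun j => Q j a) (fun j => Q j a) 0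
  have e : ∀ G : p × q → ℝ, ENNReal.ofReal (gramR (matOf G * Q))
      = ∑ a, ENNReal.ofReal ((∑ i, (∑ j, G (i, j) * Q j a) * (∑ j, G (i, j) * Q j a)
        - Fintype.card p * v * 0) ^ 2) := by
    intro G
    unfold gramR matOf
    rw [ENNReal.ofReal_sum_of_nonneg fun a _ => by positivity]
    refine Finset.sum_congr rfl fun a _ => ?_
    simp only [Matrix.mul_apply, Matrix.of_apply, mul_zero, sub_zero]
  simp_rw [e]
  rw [lintegral_finsetSum _ fun a _ => by fun_prop]
  refine (Finset.sum_le_sum fun a _ => h a).trans ?_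
  rw [← ENNReal.ofReal_sum_of_nonneg fun a _ => by positivity]
  apply ENNReal.ofReal_le_ofReal
  unfold gramR
  rw [Finset.mul_sum]
  refine Finset.sum_le_sum fun a _ => ?_
  have hn : (Fintype.card p : ℝ) ≤ (Fintype.card p : ℝ) ^ 2 := by
    norm_cast
    exact Nat.le_self_pow (by norm_num) _
  have : 0 ≤ (v : ℝ) ^ 2 * (∑ j, Q j a * Q j a) ^ 2 := by positivity
  nlinarith [mul_le_mul_of_nonneg_right hn this]

/-- Product of the hidden matrices, in curried form. -/
def midProd {w m : ℕ} (x : Fin m → (Fin w × Fin w → ℝ)) : Matrix (Fin w) (Fin w) ℝ :=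
  (List.ofFn fun l => matOf (x l)).reverse.prod

theorem midProd_succ {w m : ℕ} (x : Fin (m + 1) → (Fin w × Fin w → ℝ)) :
    midProd x = midProd (fun l => x l.succ) * matOf (x 0) := by
  simp [midProd, List.ofFn_succ]

theorem mid_bound (k : ℕ) (m : ℕ) : ∃ c : ℝ, 0 ≤ c ∧ ∀ (w : ℕ) (_ : 1 ≤ w) (v : NNReal)
    (Q : Matrix (Fin w) (Fin k) ℝ) (s : ℝ),
    ∫⁻ x, ENNReal.ofReal (gramV (midProd x * Q) ((w * v) ^ m * s))
      ∂(Measure.pi fun _ : Fin m => gPi (Fin w × Fin w) v)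
      ≤ ENNReal.ofReal (((w * v) ^ m) ^ 2 * (gramV Q s + c / w * gramR Q)) := by
  induction m with
  | zero =>
    refine ⟨0, le_rfl, fun w hw v Q s => ?_⟩
    simp [midProd]
  | succ m ih =>
    obtain ⟨c, hc, ih⟩ := ih
    refine ⟨96 * k + 97 * c, by positivity, fun w hw v Q s => ?_⟩
    have hw0 : (0 : ℝ) < w := by exact_mod_cast hw
    have mp := measurePreserving_piFinSuccAbove (fun _ : Fin (m + 1) => gPi (Fin w × Fin w) v) 0
    have e : ∫⁻ x, ENNReal.ofReal (gramV (midProd x * Q) ((w * v) ^ (m + 1) * s))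
        ∂(Measure.pi fun _ : Fin (m + 1) => gPi (Fin w × Fin w) v)
        = ∫⁻ y : (Fin w × Fin w → ℝ) × (Fin m → (Fin w × Fin w → ℝ)),
          ENNReal.ofReal (gramV (midProd y.2 * (matOf y.1 * Q)) ((w * v) ^ m * (w * v * s)))
          ∂((gPi (Fin w × Fin w) v).prod (Measure.pi fun _ : Fin m => gPi (Fin w × Fin w) v)) := by
      rw [← mp.lintegral_comp_emb (MeasurableEquiv.measurableEmbedding _)]
      refine lintegral_congr fun x => ?_
      rw [midProd_succ, Matrix.mul_assoc, pow_succ, mul_assoc]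
      rfl
    rw [e]
    refine (lintegral_prod_le _).trans ?_
    refine (lintegral_mono fun G => ih w hw v (matOf G * Q) (w * v * s)).trans ?_
    have hv := gramV_step (p := Fin w) v Q s
    have hr := gramR_step (p := Fin w) v Q
    simp only [Fintype.card_fin] at hv hr
    have e3 : ∀ G : Fin w × Fin w → ℝ, ENNReal.ofReal (((w * v) ^ m) ^ 2 *
        (gramV (matOf G * Q) (w * v * s) + c / w * gramR (matOf G * Q)))
        = ENNReal.ofReal (((w * v) ^ m) ^ 2) * ENNReal.ofReal (gramV (matOf G * Q) (w * v * s))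
        + ENNReal.ofReal (((w * v) ^ m) ^ 2 * (c / w)) * ENNReal.ofReal (gramR (matOf G * Q)) := by
      intro G
      rw [← ENNReal.ofReal_mul (by positivity), ← ENNReal.ofReal_mul (by positivity),
        ← ENNReal.ofReal_add (mul_nonneg (by positivity) (gramV_nonneg _ _))
          (mul_nonneg (by positivity) (gramR_nonneg _))]
      congr 1; ring
    simp_rw [e3]
    have mV := (measurable_gramV (p := Fin w) Q (w * v * s)).ennreal_ofReal
    have mR := (measurable_gramR (p := Fin w) Q).ennreal_ofReal
    rw [lintegral_add_left (mV.const_mul _), lintegral_const_mul _ mV, lintegral_const_mul _ mR]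
    refine (add_le_add (mul_le_mul_right hv _) (mul_le_mul_right hr _)).trans ?_
    rw [← ENNReal.ofReal_mul (by positivity), ← ENNReal.ofReal_mul (by positivity),
        ← ENNReal.ofReal_add]
    · apply ENNReal.ofReal_le_ofReal
      apply le_of_eq
      field_simp
      ring
    · have := gramV_nonneg Q s
      have := gramR_nonneg Q
      positivity
    · have := gramR_nonneg Q
      positivity

theorem dln_split (n0 nL w L : ℕ) (v : NNReal) :
    MeasurePreserving (fun θ : DLNParams n0 nL w L =>
      ((fun z => θ (Sum.inl z), (fun l z => θ (Sum.inr (Sum.inl (l, z))))) :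
        (Fin w × Fin n0 → ℝ) × (Fin (L - 2) → (Fin w × Fin w → ℝ))))
      (gPi (DLNIdx n0 nL w L) v)
      ((gPi (Fin w × Fin n0) v).prod
        (Measure.pi fun _ : Fin (L - 2) => gPi (Fin w × Fin w) v)) := by
  have m1 := measurePreserving_sumPiEquivProdPi (X := fun _ : DLNIdx n0 nL w L => ℝ)
    (fun _ : DLNIdx n0 nL w L => gaussianReal 0 v)
  have m2 := measurePreserving_sumPiEquivProdPi
    (X := fun _ : (Fin (L - 2) × Fin w × Fin w) ⊕ (Fin nL × Fin w) => ℝ)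
    (fun _ => gaussianReal 0 v)
  have m3 : MeasurePreserving Prod.fst ((gPi (Fin (L - 2) × Fin w × Fin w) v).prod
    (gPi (Fin nL × Fin w) v)) (gPi (Fin (L - 2) × Fin w × Fin w) v) := measurePreserving_fst
  have m4 := gPi_curry (Fin (L - 2)) (Fin w × Fin w) v
  have m5 := (m4.comp (m3.comp m2))
  have m6 := (MeasurePreserving.id (gPi (Fin w × Fin n0) v)).prod m5
  exact m6.comp m1

theorem dln_gram_bound (n0 nL L : ℕ) : ∃ c : ℝ, 0 ≤ c ∧ ∀ (w : ℕ) (_ : 1 ≤ w) (v : NNReal),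
    ∫⁻ θ : DLNParams n0 nL w L, ENNReal.ofReal
      (gramV ((List.ofFn (dlnWmid θ)).reverse.prod * dlnW1 θ) ((w * v) ^ (L - 2 + 1)))
      ∂(gPi (DLNIdx n0 nL w L) v)
      ≤ ENNReal.ofReal (((w * v) ^ (L - 2 + 1)) ^ 2 * (c / w)) := by
  obtain ⟨c, hc, h⟩ := mid_bound n0 (L - 2)
  refine ⟨96 * n0 * n0 + 97 * c * n0, by positivity, fun w hw v => ?_⟩
  have hw0 : (0 : ℝ) < w := by exact_mod_cast hw
  set F : (Fin w × Fin n0 → ℝ) × (Fin (L - 2) → (Fin w × Fin w → ℝ)) → ENNReal :=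
    fun y => ENNReal.ofReal
      (gramV (midProd y.2 * matOf y.1) ((w * v) ^ (L - 2) * (w * v * 1))) with hF
  have mF : Measurable F := by
    rw [hF]
    apply Measurable.ennreal_ofReal
    apply Continuous.measurable
    have c1 : Continuous fun y : (Fin w × Fin n0 → ℝ) × (Fin (L - 2) → (Fin w × Fin w → ℝ)) =>
        midProd y.2 := by
      unfold midProd
      have e : ∀ y : (Fin w × Fin n0 → ℝ) × (Fin (L - 2) → (Fin w × Fin w → ℝ)),
        (List.ofFn fun l => matOf (y.2 l)).reverse.prod
          = ((List.finRange (L - 2)).reverse.map fun l => matOf (y.2 l)).prod := by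
        intro y; rw [List.ofFn_eq_map, List.map_reverse]
      simp_rw [e]
      apply continuous_list_prod
      intro l _
      unfold matOf
      fun_prop
    have c2 : Continuous fun y : (Fin w × Fin n0 → ℝ) × (Fin (L - 2) → (Fin w × Fin w → ℝ)) =>
        matOf y.1 := by
      unfold matOf
      fun_prop
    have c3 := c1.matrix_mul c2
    have c4 := fun i j => c3.matrix_elem i j
    unfold gramV
    fun_prop
  have e : ∫⁻ θ : DLNParams n0 nL w L, ENNReal.ofReal
      (gramV ((List.ofFn (dlnWmid θ)).reverse.prod * dlnW1 θ) ((w * v) ^ (L - 2 + 1)))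
      ∂(gPi (DLNIdx n0 nL w L) v)
      = ∫⁻ y, F y ∂((gPi (Fin w × Fin n0) v).prod
        (Measure.pi fun _ : Fin (L - 2) => gPi (Fin w × Fin w) v)) := by
    rw [← (dln_split n0 nL w L v).lintegral_comp mF]
    refine lintegral_congr fun θ => ?_
    rw [hF, mul_one, ← pow_succ]
    rfl
  rw [e]
  refine (lintegral_prod_le _).trans ?_
  refine (lintegral_mono fun G => h w hw v (matOf G) (w * v * 1)).trans ?_
  have hv := gramV_step (p := Fin w) v (1 : Matrix (Fin n0) (Fin n0) ℝ) 1
  have hr := gramR_step (p := Fin w) v (1 : Matrix (Fin n0) (Fin n0) ℝ)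
  have v1 : gramV (1 : Matrix (Fin n0) (Fin n0) ℝ) 1 = 0 := by
    unfold gramV
    apply Finset.sum_eq_zero; intro a _
    apply Finset.sum_eq_zero; intro b _
    by_cases hab : a = b
    · simp [Matrix.one_apply, hab]
    · simp [Matrix.one_apply, hab, Ne.symm hab]
  have r1 : gramR (1 : Matrix (Fin n0) (Fin n0) ℝ) = n0 := by
    unfold gramR
    simp [Matrix.one_apply]
  simp only [Fintype.card_fin, Matrix.mul_one, v1, r1] at hv hr
  have e3 : ∀ G : Fin w × Fin n0 → ℝ, ENNReal.ofReal (((w * v) ^ (L - 2)) ^ 2 *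
      (gramV (matOf G) (w * v * 1) + c / w * gramR (matOf G)))
      = ENNReal.ofReal (((w * v) ^ (L - 2)) ^ 2) * ENNReal.ofReal (gramV (matOf G) (w * v * 1))
      + ENNReal.ofReal (((w * v) ^ (L - 2)) ^ 2 * (c / w)) * ENNReal.ofReal (gramR (matOf G)) := by
    intro G
    rw [← ENNReal.ofReal_mul (by positivity), ← ENNReal.ofReal_mul (by positivity),
      ← ENNReal.ofReal_add (mul_nonneg (by positivity) (gramV_nonneg _ _))
        (mul_nonneg (by positivity) (gramR_nonneg _))]
    congr 1; ring
  simp_rw [e3]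
  have mV := (measurable_gramV (p := Fin w) (1 : Matrix (Fin n0) (Fin n0) ℝ)
    (w * v * 1)).ennreal_ofReal
  have mR := (measurable_gramR (p := Fin w) (1 : Matrix (Fin n0) (Fin n0) ℝ)).ennreal_ofReal
  simp only [Matrix.mul_one] at mV mR
  rw [lintegral_add_left (mV.const_mul _), lintegral_const_mul _ mV, lintegral_const_mul _ mR]
  refine (add_le_add (mul_le_mul_right hv _) (mul_le_mul_right hr _)).trans ?_
  rw [← ENNReal.ofReal_mul (by positivity), ← ENNReal.ofReal_mul (by positivity),
      ← ENNReal.ofReal_add (by positivity) (by positivity)]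
  apply ENNReal.ofReal_le_ofReal
  apply le_of_eq
  field_simp
  ring

/-- A Gram matrix close to `s • 1` is bounded below. -/
theorem gramV_lower {p k : Type} [Fintype p] [Fintype k] [DecidableEq k] (Q : Matrix p k ℝ)
    (s : ℝ) (hs : 0 ≤ s) (h : gramV Q s ≤ (s / 2) ^ 2) (x : k → ℝ) :
    s / 2 * ∑ a, x a ^ 2 ≤ ∑ i, (Q.mulVec x i) ^ 2 := by
  have e1 : ∑ i, (Q.mulVec x i) ^ 2 = ∑ a, ∑ b, (∑ i, Q i a * Q i b) * (x a * x b) := by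
    have : ∀ i, (Q.mulVec x i) ^ 2 = ∑ a, ∑ b, (Q i a * Q i b) * (x a * x b) := by
      intro i
      simp only [Matrix.mulVec, dotProduct]
      rw [sq, Finset.sum_mul_sum]
      exact Finset.sum_congr rfl fun a _ => Finset.sum_congr rfl fun b _ => by ring
    simp_rw [this]
    rw [Finset.sum_comm]
    refine Finset.sum_congr rfl fun a _ => ?_
    rw [Finset.sum_comm]
    refine Finset.sum_congr rfl fun b _ => ?_
    rw [Finset.sum_mul]
  have e2 : s * ∑ a, x a ^ 2 = ∑ a, ∑ b, (if a = b then s else 0) * (x a * x b) := by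
    simp [Finset.mul_sum, sq]
  set E : k × k → ℝ := fun z => ∑ i, Q i z.1 * Q i z.2 - if z.1 = z.2 then s else 0 with hE
  have e3 : ∑ i, (Q.mulVec x i) ^ 2 - s * ∑ a, x a ^ 2 = ∑ z, E z * (x z.1 * x z.2) := by
    rw [e1, e2, Fintype.sum_prod_type, ← Finset.sum_sub_distrib]
    refine Finset.sum_congr rfl fun a _ => ?_
    rw [← Finset.sum_sub_distrib]
    exact Finset.sum_congr rfl fun b _ => by rw [hE]; ring
  have e4 : gramV Q s = ∑ z, E z ^ 2 := by
    rw [Fintype.sum_prod_type]; rfl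
  have e5 : ∑ z : k × k, (x z.1 * x z.2) ^ 2 = (∑ a, x a ^ 2) ^ 2 := by
    rw [Fintype.sum_prod_type, sq (∑ a, x a ^ 2), Finset.sum_mul_sum]
    exact Finset.sum_congr rfl fun a _ => Finset.sum_congr rfl fun b _ => by ring
  have cs := Finset.sum_mul_sq_le_sq_mul_sq Finset.univ E (fun z => x z.1 * x z.2)
  rw [e5, ← e4, ← e3] at cs
  have hx : 0 ≤ ∑ a, x a ^ 2 := by positivity
  have := abs_le_of_sq_le_sq' (a := ∑ i, (Q.mulVec x i) ^ 2 - s * ∑ a, x a ^ 2)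
    (b := s / 2 * ∑ a, x a ^ 2) (by nlinarith [sq_nonneg (∑ a, x a ^ 2)]) (by positivity)
  linarith [this.1]

theorem gPi_mgf_sub {ι κ : Type} [Fintype ι] [Fintype κ] (v : NNReal) (e : κ → ι)
    (he : Function.Injective e) (c : κ → ℝ) :
    ∫⁻ x, ENNReal.ofReal (Real.exp (∑ k, c k * x (e k))) ∂(gPi ι v)
      = ENNReal.ofReal (Real.exp (v * (∑ k, c k ^ 2) / 2)) := by
  have h := gPi_mgf_lintegral v (Function.extend e c 0)
  have h1 : ∀ x : ι → ℝ, ∑ k, c k * x (e k) = ∑ i, Function.extend e c 0 i * x i := by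
    intro x
    apply Fintype.sum_of_injective e he
    · intro i hi
      rw [Function.extend_apply' _ _ _ (by simpa using hi)]; simp
    · intro k
      rw [he.extend_apply]
  have h2 : ∑ k, c k ^ 2 = ∑ i, (Function.extend e c 0 i) ^ 2 := by
    apply Fintype.sum_of_injective e he
    · intro i hi
      rw [Function.extend_apply' _ _ _ (by simpa using hi)]; simp
    · intro k
      rw [he.extend_apply]
  simp_rw [h1, h2]
  exact h

section opnorm
open scoped Matrix.Norms.L2Operator RealInnerProductSpace

theorem opnorm_witness {w : ℕ} (A : Matrix (Fin w) (Fin w) ℝ) (hA : 0 < ‖A‖) :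
    ∃ u y₀ : EuclideanSpace ℝ (Fin w), ‖u‖ ≤ 1 ∧ ‖y₀‖ ≤ 1 ∧
      ∀ x ∈ Metric.ball u (1 / 4), ∀ y ∈ Metric.ball y₀ (1 / 4),
        3 / 16 * ‖A‖ ≤ ∑ z : Fin w × Fin w, (y z.1 * x z.2) * A z.1 z.2 := by
  set T := Matrix.toEuclideanCLM (n := Fin w) (𝕜 := ℝ) A with hT
  have hTA : ‖T‖ = ‖A‖ := Matrix.l2_opNorm_toEuclideanCLM A
  obtain ⟨u, hu, hlt⟩ := ContinuousLinearMap.exists_lt_apply_of_lt_opNorm T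
    (r := 3 / 4 * ‖T‖) (by rw [hTA]; linarith)
  have hTu : 0 < ‖T u‖ := lt_of_le_of_lt (by positivity) hlt
  refine ⟨u, (‖T u‖)⁻¹ • T u, hu.le, ?_, ?_⟩
  · rw [norm_smul, norm_inv, norm_norm, inv_mul_cancel₀ hTu.ne']
  · intro x hx y hy
    set y₀ := (‖T u‖)⁻¹ • T u with hy0
    have n0 : ‖y₀‖ = 1 := by
      rw [hy0, norm_smul, norm_inv, norm_norm, inv_mul_cancel₀ hTu.ne']
    have e1 : ⟪y₀, T u⟫ = ‖T u‖ := by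
      rw [hy0, real_inner_smul_left, real_inner_self_eq_norm_sq]
      field_simp
    have e2 : ∑ z : Fin w × Fin w, (y z.1 * x z.2) * A z.1 z.2 = ⟪y, T x⟫ := by
      rw [hT, Matrix.inner_toEuclideanCLM, Fintype.sum_prod_type]
      simp only [dotProduct, Matrix.mulVec, Finset.mul_sum]
      exact Finset.sum_congr rfl fun i _ => Finset.sum_congr rfl fun j _ => by ring
    rw [e2]
    have e3 : ⟪y, T x⟫ = ⟪y₀, T u⟫ + ⟪y - y₀, T u⟫ + ⟪y, T (x - u)⟫ := by
      rw [map_sub, inner_sub_left, inner_sub_right]; ring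
    rw [Metric.mem_ball, dist_eq_norm] at hx hy
    have b0 : ‖T u‖ ≤ ‖T‖ := by
      calc ‖T u‖ ≤ ‖T‖ * ‖u‖ := T.le_opNorm u
        _ ≤ ‖T‖ * 1 := by gcongr
        _ = ‖T‖ := mul_one _
    have b1 : |⟪y - y₀, T u⟫| ≤ 1 / 4 * ‖T‖ := by
      refine (abs_real_inner_le_norm _ _).trans ?_
      gcongr
    have ny : ‖y‖ ≤ 5 / 4 := by
      have : y = (y - y₀) + y₀ := by abel
      rw [this]
      refine (norm_add_le _ _).trans ?_
      linarith
    have b2 : |⟪y, T (x - u)⟫| ≤ 5 / 4 * (‖T‖ * (1 / 4)) := by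
      refine (abs_real_inner_le_norm _ _).trans ?_
      have : ‖T (x - u)‖ ≤ ‖T‖ * (1 / 4) := (T.le_opNorm _).trans (by gcongr)
      gcongr
    have c1 := (abs_le.mp b1).1
    have c2 := (abs_le.mp b2).1
    rw [e3, e1, ← hTA]
    linarith


abbrev EW (w : ℕ) := EuclideanSpace ℝ (Fin w)

def tailF {ι : Type} {w : ℕ} (l : ℝ) (e : Fin w × Fin w → ι) (θ : ι → ℝ) (z : EW w × EW w) :
    ENNReal :=
  ENNReal.ofReal (Real.exp (∑ k : Fin w × Fin w, (l * (z.2 k.1 * z.1 k.2)) * θ (e k)))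

def tailT (w : ℕ) : Measure (EW w × EW w) :=
  ((volume : Measure (EW w)).prod (volume : Measure (EW w))).restrict
    (Metric.ball 0 2 ×ˢ Metric.ball 0 2)

instance (w : ℕ) : SFinite (tailT w) := by unfold tailT; infer_instance

theorem tailF_meas {ι : Type} [Fintype ι] {w : ℕ} (l : ℝ) (e : Fin w × Fin w → ι) :
    Measurable (Function.uncurry (tailF l e)) := by
  unfold tailF
  apply Measurable.ennreal_ofReal
  apply Continuous.measurable
  fun_prop

theorem vol_ball (w : ℕ) (x : EW w) (r : ℝ) (hr : 0 < r) :
    (volume : Measure (EW w)) (Metric.ball x r)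
      = ENNReal.ofReal (r ^ w) * (volume : Measure (EW w)) (Metric.ball 0 1) := by
  rw [Measure.addHaar_ball_of_pos _ _ hr, finrank_euclideanSpace_fin]

theorem tail_up {ι : Type} [Fintype ι] {w : ℕ} (v : NNReal) (hv : 0 < v)
    (e : Fin w × Fin w → ι) (he : Function.Injective e) (b : ENNReal)
    (hb : b = (volume : Measure (EW w)) (Metric.ball 0 1)) :
    ∫⁻ θ, ∫⁻ z, tailF (Real.sqrt (w / v)) e θ z ∂(tailT w) ∂(gPi ι v)
      ≤ ENNReal.ofReal (Real.exp (8 * w)) * ((ENNReal.ofReal (2 ^ w) * b) *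
        (ENNReal.ofReal (2 ^ w) * b)) := by
  have hv0 : (0 : ℝ) < v := by exact_mod_cast hv
  rw [lintegral_lintegral_swap (tailF_meas _ e).aemeasurable]
  have hBm : MeasurableSet ((Metric.ball (0 : EW w) 2) ×ˢ (Metric.ball (0 : EW w) 2)) :=
    Metric.isOpen_ball.measurableSet.prod Metric.isOpen_ball.measurableSet
  unfold tailT
  refine (setLIntegral_mono' (g := fun _ => ENNReal.ofReal (Real.exp (8 * w))) hBm ?_).trans ?_
  · rintro ⟨x, y⟩ ⟨hx, hy⟩
    unfold tailF
    rw [gPi_mgf_sub v e he]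
    apply ENNReal.ofReal_le_ofReal
    apply Real.exp_le_exp.mpr
    simp only
    have s1 : ∑ k : Fin w × Fin w, (Real.sqrt (w / v) * (y k.1 * x k.2)) ^ 2
        = Real.sqrt (w / v) ^ 2 * (‖y‖ ^ 2 * ‖x‖ ^ 2) := by
      rw [EuclideanSpace.real_norm_sq_eq, EuclideanSpace.real_norm_sq_eq, Finset.sum_mul_sum,
        Fintype.sum_prod_type, Finset.mul_sum]
      refine Finset.sum_congr rfl fun i _ => ?_
      rw [Finset.mul_sum]
      exact Finset.sum_congr rfl fun j _ => by ring
    rw [s1, Real.sq_sqrt (by positivity)]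
    simp only [Metric.mem_ball, dist_zero_right] at hx hy
    have hx2 : ‖x‖ ^ 2 ≤ 4 := by nlinarith [norm_nonneg x]
    have hy2 : ‖y‖ ^ 2 ≤ 4 := by nlinarith [norm_nonneg y]
    have h16 : ‖y‖ ^ 2 * ‖x‖ ^ 2 ≤ 16 := by nlinarith [sq_nonneg ‖x‖, sq_nonneg ‖y‖]
    have : (v : ℝ) * (w / v * (‖y‖ ^ 2 * ‖x‖ ^ 2)) / 2 = w * (‖y‖ ^ 2 * ‖x‖ ^ 2) / 2 := by
      field_simp
    rw [this]
    have hw0 : (0 : ℝ) ≤ w := by positivity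
    nlinarith
  · rw [setLIntegral_const, Measure.prod_prod, vol_ball w 0 2 (by norm_num), ← hb]

theorem tail_low {ι : Type} [Fintype ι] {w : ℕ} (hw : 1 ≤ w) (v : NNReal) (hv : 0 < v)
    (e : Fin w × Fin w → ι) (b : ENNReal)
    (hb : b = (volume : Measure (EW w)) (Metric.ball 0 1)) (θ : ι → ℝ)
    (hθ : 100 * Real.sqrt (w * v)
        ≤ ‖(Matrix.of fun i j => θ (e (i, j)) : Matrix (Fin w) (Fin w) ℝ)‖) :
    ENNReal.ofReal (Real.exp (18 * w)) * ((ENNReal.ofReal ((1 / 4) ^ w) * b) *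
        (ENNReal.ofReal ((1 / 4) ^ w) * b)) ≤
      ∫⁻ z, tailF (Real.sqrt (w / v)) e θ z ∂(tailT w) := by
  have hw0 : (0 : ℝ) < w := by exact_mod_cast hw
  have hv0 : (0 : ℝ) < v := by exact_mod_cast hv
  obtain ⟨A, hA⟩ : ∃ A : Matrix (Fin w) (Fin w) ℝ, A = Matrix.of fun i j => θ (e (i, j)) :=
    ⟨_, rfl⟩
  rw [← hA] at hθ
  have hApos : 0 < ‖A‖ := lt_of_lt_of_le (by positivity) hθ
  obtain ⟨u, y₀, hu, hy₀, h⟩ := opnorm_witness A hApos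
  have hUm : MeasurableSet (Metric.ball u (1 / 4) ×ˢ Metric.ball y₀ (1 / 4)) :=
    Metric.isOpen_ball.measurableSet.prod Metric.isOpen_ball.measurableSet
  have sub : ∀ u : EW w, ‖u‖ ≤ 1 → Metric.ball u (1 / 4) ⊆ Metric.ball 0 2 := by
    intro u hu
    apply Metric.ball_subset_ball'
    rw [dist_zero_right]; linarith
  have hτU : tailT w (Metric.ball u (1 / 4) ×ˢ Metric.ball y₀ (1 / 4))
      = (ENNReal.ofReal ((1 / 4) ^ w) * b) * (ENNReal.ofReal ((1 / 4) ^ w) * b) := by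
    unfold tailT
    rw [Measure.restrict_eq_self _ (Set.prod_mono (sub u hu) (sub y₀ hy₀)), Measure.prod_prod,
      vol_ball w _ _ (by norm_num), vol_ball w y₀ _ (by norm_num), ← hb]
  rw [← hτU, ← setLIntegral_const]
  refine le_trans ?_ (setLIntegral_le_lintegral (Metric.ball u (1 / 4) ×ˢ Metric.ball y₀ (1 / 4)) _)
  refine setLIntegral_mono' hUm ?_
  rintro ⟨x, y⟩ ⟨hx, hy⟩
  unfold tailF
  apply ENNReal.ofReal_le_ofReal
  apply Real.exp_le_exp.mpr
  simp only
  have h1 := h x hx y hy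
  have h2 : ∑ k : Fin w × Fin w, (Real.sqrt (w / v) * (y k.1 * x k.2)) * θ (e k)
      = Real.sqrt (w / v) * ∑ z : Fin w × Fin w, (y z.1 * x z.2) * A z.1 z.2 := by
    rw [Finset.mul_sum]
    exact Finset.sum_congr rfl fun k _ => by rw [hA]; simp [mul_assoc]
  rw [h2]
  have hl0 : 0 ≤ Real.sqrt (w / v) := Real.sqrt_nonneg _
  have h3 : Real.sqrt (w / v) * (3 / 16 * (100 * Real.sqrt (w * v))) ≤
      Real.sqrt (w / v) * ∑ z : Fin w × Fin w, (y z.1 * x z.2) * A z.1 z.2 := by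
    apply mul_le_mul_of_nonneg_left _ hl0
    linarith
  have h4 : Real.sqrt (w / v) * Real.sqrt (w * v) = w := by
    rw [← Real.sqrt_mul (by positivity)]
    have : (w : ℝ) / v * (w * v) = w ^ 2 := by field_simp
    rw [this, Real.sqrt_sq hw0.le]
  nlinarith

theorem tail_numeric (w : ℕ) : Real.exp (8 * w) * (2 ^ w * 2 ^ w) ≤
    Real.exp (18 * w) * ((1 / 4 : ℝ) ^ w * (1 / 4) ^ w) * Real.exp (-(w : ℝ)) := by
  have h64 : (64 : ℝ) ^ w ≤ Real.exp (9 * w) := by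
    have h2 : (2 : ℝ) ≤ Real.exp 1 := by
      have := Real.add_one_le_exp (1 : ℝ); linarith
    have : (64 : ℝ) ≤ Real.exp 9 := by
      have h9 : Real.exp 9 = Real.exp 1 ^ 9 := by rw [← Real.exp_nat_mul]; norm_num
      rw [h9]
      calc (64 : ℝ) ≤ 2 ^ 9 := by norm_num
        _ ≤ Real.exp 1 ^ 9 := by gcongr
    calc (64 : ℝ) ^ w ≤ Real.exp 9 ^ w := by gcongr
      _ = Real.exp (9 * w) := by rw [← Real.exp_nat_mul, mul_comm]
  have q1 : (2 : ℝ) ^ w * 2 ^ w = 64 ^ w * ((1 / 4) ^ w * (1 / 4) ^ w) := by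
    rw [← mul_pow, ← mul_pow, ← mul_pow]; norm_num
  have q2 : Real.exp (18 * w) * Real.exp (-(w : ℝ)) = Real.exp (8 * w) * Real.exp (9 * w) := by
    rw [← Real.exp_add, ← Real.exp_add]; congr 1; ring
  calc Real.exp (8 * w) * (2 ^ w * 2 ^ w)
      = (Real.exp (8 * w) * 64 ^ w) * ((1 / 4) ^ w * (1 / 4) ^ w) := by rw [q1]; ring
    _ ≤ (Real.exp (8 * w) * Real.exp (9 * w)) * ((1 / 4) ^ w * (1 / 4) ^ w) := by gcongr
    _ = Real.exp (18 * w) * ((1 / 4) ^ w * (1 / 4) ^ w) * Real.exp (-(w : ℝ)) := by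
      rw [← q2]; ring

theorem tail_ennreal (w : ℕ) (b P : ENNReal) (hb0 : b ≠ 0) (hbt : b ≠ ⊤)
    (h : ENNReal.ofReal (Real.exp (18 * w)) * ((ENNReal.ofReal ((1 / 4) ^ w) * b) *
        (ENNReal.ofReal ((1 / 4) ^ w) * b)) * P ≤
      ENNReal.ofReal (Real.exp (8 * w)) * ((ENNReal.ofReal (2 ^ w) * b) *
        (ENNReal.ofReal (2 ^ w) * b))) : P ≤ ENNReal.ofReal (Real.exp (-(w : ℝ))) := by
  have r1 : ENNReal.ofReal (Real.exp (18 * w)) * ((ENNReal.ofReal ((1 / 4) ^ w) * b) *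
        (ENNReal.ofReal ((1 / 4) ^ w) * b)) * P
      = (b * b) * (ENNReal.ofReal (Real.exp (18 * w) * ((1 / 4) ^ w * (1 / 4) ^ w)) * P) := by
    rw [ENNReal.ofReal_mul (by positivity), ENNReal.ofReal_mul (by positivity)]
    ring
  have r2 : ENNReal.ofReal (Real.exp (8 * w)) * ((ENNReal.ofReal (2 ^ w) * b) *
        (ENNReal.ofReal (2 ^ w) * b))
      = (b * b) * ENNReal.ofReal (Real.exp (8 * w) * (2 ^ w * 2 ^ w)) := by
    rw [ENNReal.ofReal_mul (by positivity), ENNReal.ofReal_mul (by positivity)]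
    ring
  rw [r1, r2, ENNReal.mul_le_mul_iff_right (mul_ne_zero hb0 hb0) (ENNReal.mul_ne_top hbt hbt)] at h
  have hc : 0 < Real.exp (18 * w) * ((1 / 4 : ℝ) ^ w * (1 / 4) ^ w) := by positivity
  rw [← ENNReal.mul_le_mul_iff_right (a := ENNReal.ofReal
    (Real.exp (18 * w) * ((1 / 4 : ℝ) ^ w * (1 / 4) ^ w)))
    (ENNReal.ofReal_pos.mpr hc).ne' ENNReal.ofReal_ne_top]
  refine h.trans ?_
  rw [← ENNReal.ofReal_mul hc.le]
  exact ENNReal.ofReal_le_ofReal (tail_numeric w)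

theorem opnorm_tail {ι : Type} [Fintype ι] {w : ℕ} (hw : 1 ≤ w) (v : NNReal) (hv : 0 < v)
    (e : Fin w × Fin w → ι) (he : Function.Injective e) :
    gPi ι v {θ | 100 * Real.sqrt (w * v)
        ≤ ‖(Matrix.of fun i j => θ (e (i, j)) : Matrix (Fin w) (Fin w) ℝ)‖}
      ≤ ENNReal.ofReal (Real.exp (-(w : ℝ))) := by
  obtain ⟨b, hb⟩ : ∃ b, b = (volume : Measure (EW w)) (Metric.ball 0 1) := ⟨_, rfl⟩
  have hb0 : b ≠ 0 := hb ▸ (Metric.measure_ball_pos _ _ one_pos).ne'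
  have hbt : b ≠ ⊤ := hb ▸ measure_ball_lt_top.ne
  have hIm : Measurable fun θ => ∫⁻ z, tailF (Real.sqrt (w / v)) e θ z ∂(tailT w) :=
    (tailF_meas _ e).lintegral_prod_right'
  have mk := mul_meas_ge_le_lintegral (μ := gPi ι v) hIm
    (ENNReal.ofReal (Real.exp (18 * w)) * ((ENNReal.ofReal ((1 / 4) ^ w) * b) *
        (ENNReal.ofReal ((1 / 4) ^ w) * b)))
  refine le_trans (measure_mono fun θ hθ => ?_)
    (tail_ennreal w b _ hb0 hbt (mk.trans (tail_up v hv e he b hb)))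
  exact tail_low hw v hv e b hb θ hθ
end opnorm

/-- The product of the hidden matrices times `W₁`. -/
def dlnN {n0 nL w L : ℕ} (θ : DLNParams n0 nL w L) : Matrix (Fin w) (Fin n0) ℝ :=
  (List.ofFn (dlnWmid θ)).reverse.prod * dlnW1 θ

theorem dlnMatrix_eq {n0 nL w L : ℕ} (θ : DLNParams n0 nL w L) (i : Fin nL) (j : Fin n0) :
    dlnMatrix θ i j = ∑ k, θ (Sum.inr (Sum.inr (i, k))) * dlnN θ k j := by
  unfold dlnMatrix dlnN
  rw [Matrix.mul_assoc, Matrix.mul_apply]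
  rfl

theorem list_ofFn_rev {α : Type} [Monoid α] {m : ℕ} (f : Fin m → α) :
    (List.ofFn f).reverse.prod = ((List.finRange m).reverse.map f).prod := by
  rw [List.ofFn_eq_map, List.map_reverse]

theorem diff_listprod {n0 nL w L : ℕ} (l : List (Fin (L - 2))) (i j : Fin w) :
    Differentiable ℝ (fun θ : DLNParams n0 nL w L => (l.map (dlnWmid θ)).prod i j) := by
  induction l generalizing i j with
  | nil => simp
  | cons a l ih =>
    simp only [List.map_cons, List.prod_cons, Matrix.mul_apply, dlnWmid, Matrix.of_apply] at ih ⊢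
    fun_prop

theorem diff_dlnN {n0 nL w L : ℕ} (i : Fin w) (j : Fin n0) :
    Differentiable ℝ (fun θ : DLNParams n0 nL w L => dlnN θ i j) := by
  unfold dlnN
  simp only [list_ofFn_rev, Matrix.mul_apply, dlnW1, Matrix.of_apply]
  have h := fun i j => diff_listprod (n0 := n0) (nL := nL) (w := w) (L := L)
    (List.finRange (L - 2)).reverse i j
  fun_prop

def dlnMask {n0 nL w L : ℕ} : DLNIdx n0 nL w L → ℝ
  | Sum.inl _ => 1
  | Sum.inr (Sum.inl z) => if z.2.2.val < n0 then 1 else 0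
  | Sum.inr (Sum.inr _) => 1

theorem dlnMask_nonneg {n0 nL w L : ℕ} (i : DLNIdx n0 nL w L) : 0 ≤ dlnMask i := by
  rcases i with i | i | i <;> simp only [dlnMask] <;> try positivity

theorem mask_card (n0 w : ℕ) (c : ℝ) (hc : 0 ≤ c) :
    ∑ j : Fin w, (if j.val < n0 then c else 0) ≤ n0 * c := by
  rw [Fin.sum_univ_eq_sum_range (fun j => if j < n0 then c else 0), ← Finset.sum_filter]
  rw [Finset.sum_const, nsmul_eq_mul]
  have : ((Finset.range w).filter (· < n0)).card ≤ n0 := by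
    calc _ ≤ (Finset.range n0).card := Finset.card_le_card (by intro x; simp)
      _ = n0 := by simp
  have : (((Finset.range w).filter (· < n0)).card : ℝ) ≤ n0 := by exact_mod_cast this
  gcongr

theorem dlnMask_sum (n0 nL w L : ℕ) :
    ∑ i : DLNIdx n0 nL w L, dlnMask i ≤ w * (n0 + (L - 2 : ℕ) * n0 + nL) := by
  rw [Fintype.sum_sum_type, Fintype.sum_sum_type]
  have h1 : ∑ z : Fin w × Fin n0, dlnMask (Sum.inl z : DLNIdx n0 nL w L) = w * n0 := by
    simp [dlnMask]
  have h3 : ∑ z : Fin nL × Fin w, dlnMask (Sum.inr (Sum.inr z) : DLNIdx n0 nL w L)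
      = nL * w := by
    simp [dlnMask]
  have h2 : ∑ z : Fin (L - 2) × Fin w × Fin w,
      dlnMask (Sum.inr (Sum.inl z) : DLNIdx n0 nL w L) ≤ (L - 2 : ℕ) * (w * (n0 * 1)) := by
    rw [Fintype.sum_prod_type]
    calc _ ≤ ∑ _x : Fin (L - 2), ((w : ℝ) * (n0 * 1)) := ?_
      _ = _ := by simp
    refine Finset.sum_le_sum fun x _ => ?_
    rw [Fintype.sum_prod_type]
    calc _ ≤ ∑ _x : Fin w, ((n0 : ℝ) * 1) := ?_
      _ = _ := by simp
    exact Finset.sum_le_sum fun y _ => mask_card n0 w 1 (by norm_num)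
  rw [h1, h3]
  linarith

theorem mask_lintegral {n0 nL w L : ℕ} (v : NNReal) :
    ∫⁻ θ : DLNParams n0 nL w L, ENNReal.ofReal (∑ i, dlnMask i * θ i ^ 2)
      ∂(gPi (DLNIdx n0 nL w L) v)
      ≤ ENNReal.ofReal (v * (w * (n0 + (L - 2 : ℕ) * n0 + nL))) := by
  have e : ∀ (i : DLNIdx n0 nL w L) (x : DLNParams n0 nL w L),
      ∑ k, (Pi.single i 1 : DLNIdx n0 nL w L → ℝ) k * x k = x i := by
    intro i x
    simp [Pi.single_apply]
  have hi : ∀ i : DLNIdx n0 nL w L, Integrable (fun θ : DLNParams n0 nL w L => θ i ^ 2)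
      (gPi (DLNIdx n0 nL w L) v) := by
    intro i
    have := (gPi_memLp v (Pi.single i 1 : DLNIdx n0 nL w L → ℝ) 2).integrable_sq
    simpa only [e] using this
  have hs : ∀ i : DLNIdx n0 nL w L, ∫ θ : DLNParams n0 nL w L, θ i ^ 2
      ∂(gPi (DLNIdx n0 nL w L) v) = v := by
    intro i
    have := gPi_sq v (Pi.single i 1 : DLNIdx n0 nL w L → ℝ)
    simp only [e] at this
    rw [this]
    simp [Pi.single_apply]
  rw [← ofReal_integral_eq_lintegral_ofReal
    (integrable_finsetSum _ fun i _ => (hi i).const_mul _)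
    (Filter.Eventually.of_forall fun θ => Finset.sum_nonneg fun i _ =>
      mul_nonneg (dlnMask_nonneg i) (sq_nonneg _))]
  apply ENNReal.ofReal_le_ofReal
  rw [integral_finsetSum _ fun i _ => (hi i).const_mul _]
  simp_rw [integral_const_mul, hs]
  rw [← Finset.sum_mul, mul_comm]
  exact mul_le_mul_of_nonneg_left (dlnMask_sum n0 nL w L) v.2

section good
open scoped Matrix.Norms.L2Operator

def DLNGood {n0 nL w L : ℕ} (K ρ : ℝ) (θ : DLNParams n0 nL w L) : Prop :=
  (∀ ℓ, ‖dlnWmid θ ℓ‖ ≤ K * Real.sqrt ρ) ∧ ∑ i, dlnMask i * θ i ^ 2 ≤ K ^ 2 * ρ ∧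
    gramV (dlnN θ) (ρ ^ (L - 2 + 1)) ≤ (ρ ^ (L - 2 + 1) / 2) ^ 2

theorem markov_helper {Ω : Type} [MeasurableSpace Ω] (μ : Measure Ω) (f : Ω → ℝ)
    (hf : Measurable f) (t q : ℝ) (ht : 0 < t)
    (h : ∫⁻ x, ENNReal.ofReal (f x) ∂μ ≤ ENNReal.ofReal (t * q)) :
    μ {x | t < f x} ≤ ENNReal.ofReal q := by
  have h1 := (mul_meas_ge_le_lintegral (μ := μ) hf.ennreal_ofReal (ENNReal.ofReal t)).trans h
  rw [ENNReal.ofReal_mul ht.le, ENNReal.mul_le_mul_iff_right (ENNReal.ofReal_pos.mpr ht).ne'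
    ENNReal.ofReal_ne_top] at h1
  refine (measure_mono fun x hx => ?_).trans h1
  exact ENNReal.ofReal_le_ofReal (le_of_lt hx)

theorem good_prob (n0 nL L : ℕ) (ε : ℝ) (hε : 0 < ε) : ∃ K : ℝ, 100 ≤ K ∧ ∃ w₀ : ℕ, 1 ≤ w₀ ∧
    ∀ w : ℕ, w₀ ≤ w → ∀ v : NNReal, 0 < v →
      gPi (DLNIdx n0 nL w L) v {θ | ¬ DLNGood K (w * v) θ} < ENNReal.ofReal ε := by
  obtain ⟨c, hc, hgb⟩ := dln_gram_bound n0 nL L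
  set c0 : ℝ := n0 + (L - 2 : ℕ) * n0 + nL with hc0
  have hc00 : 0 ≤ c0 := by positivity
  obtain ⟨K, hK, hK1⟩ : ∃ K : ℝ, 100 ≤ K ∧ c0 / K ^ 2 ≤ ε / 4 := by
    refine ⟨100 + 4 * c0 / ε, by have : 0 ≤ 4 * c0 / ε := by positivity
                                 linarith, ?_⟩
    have h0 : 0 ≤ 4 * c0 / ε := by positivity
    rw [div_le_iff₀ (by positivity)]
    have : 4 * c0 / ε ≤ (100 + 4 * c0 / ε) ^ 2 := by nlinarith
    calc c0 = ε / 4 * (4 * c0 / ε) := by field_simp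
      _ ≤ _ := by gcongr
  have ht : Filter.Tendsto (fun w : ℕ => ((L - 2 : ℕ) : ℝ) * Real.exp (-(w : ℝ)) + 4 * c / w)
      Filter.atTop (nhds 0) := by
    have h1 : Filter.Tendsto (fun w : ℕ => Real.exp (-(w : ℝ))) Filter.atTop (nhds 0) :=
      Real.tendsto_exp_neg_atTop_nhds_zero.comp tendsto_natCast_atTop_atTop
    have h2 : Filter.Tendsto (fun w : ℕ => 4 * c / (w : ℝ)) Filter.atTop (nhds 0) :=
      tendsto_const_div_atTop_nhds_zero_nat _
    simpa using (h1.const_mul ((L - 2 : ℕ) : ℝ)).add h2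
  obtain ⟨w1, hw1⟩ := (Filter.eventually_atTop.mp (ht.eventually (gt_mem_nhds
    (show (0 : ℝ) < ε / 4 by positivity))))
  refine ⟨K, hK, max 1 w1, le_max_left _ _, fun w hw v hv => ?_⟩
  have hw1' := hw1 w ((le_max_right _ _).trans hw)
  have hwn : 1 ≤ w := (le_max_left _ _).trans hw
  have hw0 : (0 : ℝ) < w := by exact_mod_cast hwn
  have hv0 : (0 : ℝ) < v := by exact_mod_cast hv
  set ρ : ℝ := w * v with hρ
  have hρ0 : 0 < ρ := by positivity
  have p1 : ∀ ℓ : Fin (L - 2), gPi (DLNIdx n0 nL w L) v {θ | K * Real.sqrt ρ < ‖dlnWmid θ ℓ‖}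
      ≤ ENNReal.ofReal (Real.exp (-(w : ℝ))) := by
    intro ℓ
    have := opnorm_tail hwn v hv (fun z => (Sum.inr (Sum.inl (ℓ, z)) : DLNIdx n0 nL w L))
      (by intro a b h; simpa using h)
    refine (measure_mono fun θ hθ => ?_).trans this
    have h1 : K * Real.sqrt ρ < ‖dlnWmid θ ℓ‖ := hθ
    have h2 : 100 * Real.sqrt ρ ≤ K * Real.sqrt ρ := by gcongr
    exact h2.trans h1.le
  have p1' : gPi (DLNIdx n0 nL w L) v (⋃ ℓ, {θ | K * Real.sqrt ρ < ‖dlnWmid θ ℓ‖})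
      ≤ ENNReal.ofReal (((L - 2 : ℕ) : ℝ) * Real.exp (-(w : ℝ))) := by
    refine (measure_iUnion_fintype_le _ _).trans ((Finset.sum_le_sum fun ℓ _ => p1 ℓ).trans ?_)
    rw [Finset.sum_const, Finset.card_univ, Fintype.card_fin, nsmul_eq_mul,
      ENNReal.ofReal_mul (by positivity), ENNReal.ofReal_natCast]
  have p2 : gPi (DLNIdx n0 nL w L) v {θ | K ^ 2 * ρ < ∑ i, dlnMask i * θ i ^ 2}
      ≤ ENNReal.ofReal (c0 / K ^ 2) := by
    apply markov_helper _ _ (by fun_prop) _ _ (by positivity)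
    refine (mask_lintegral v).trans (ENNReal.ofReal_le_ofReal (le_of_eq ?_))
    rw [← hc0, hρ]; field_simp
  have p3 : gPi (DLNIdx n0 nL w L) v
      {θ | (ρ ^ (L - 2 + 1) / 2) ^ 2 < gramV (dlnN θ) (ρ ^ (L - 2 + 1))}
      ≤ ENNReal.ofReal (4 * c / w) := by
    apply markov_helper _ _ _ _ _ (by positivity)
    · refine (hgb w hwn v).trans (ENNReal.ofReal_le_ofReal (le_of_eq ?_))
      rw [← hρ]; field_simp; ring
    · have h := fun i j => (diff_dlnN (n0 := n0) (nL := nL) (w := w) (L := L) i j).continuous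
      apply Continuous.measurable
      unfold gramV
      fun_prop
  have hsub : {θ : DLNParams n0 nL w L | ¬ DLNGood K ρ θ} ⊆
      ((⋃ ℓ, {θ | K * Real.sqrt ρ < ‖dlnWmid θ ℓ‖}) ∪
        {θ | K ^ 2 * ρ < ∑ i, dlnMask i * θ i ^ 2}) ∪
        {θ | (ρ ^ (L - 2 + 1) / 2) ^ 2 < gramV (dlnN θ) (ρ ^ (L - 2 + 1))} := by
    intro θ hθ
    by_contra hcon
    simp only [Set.mem_union, Set.mem_iUnion, Set.mem_ofPred_eq, not_or, not_exists, not_lt] at hcon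
    exact hθ ⟨hcon.1.1, hcon.1.2, hcon.2⟩
  calc _ ≤ _ := measure_mono hsub
    _ ≤ _ := measure_union_le _ _
    _ ≤ _ := add_le_add (measure_union_le _ _) le_rfl
    _ ≤ (ENNReal.ofReal (((L - 2 : ℕ) : ℝ) * Real.exp (-(w : ℝ))) +
        ENNReal.ofReal (c0 / K ^ 2)) + ENNReal.ofReal (4 * c / w) := by gcongr
    _ < ENNReal.ofReal ε := by
      rw [← ENNReal.ofReal_add (by positivity) (by positivity),
        ← ENNReal.ofReal_add (by positivity) (by positivity),
        ENNReal.ofReal_lt_ofReal_iff hε]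
      linarith
end good

/-- Replacement parameter: realizes `s^L • B`, and only changes the masked entries of `θ`. -/
def dlnTh {n0 nL w L : ℕ} (θ : DLNParams n0 nL w L) (s : ℝ) (B : Fin nL → Fin n0 → ℝ) :
    DLNParams n0 nL w L
  | Sum.inl z => if z.1.val = z.2.val then s else 0
  | Sum.inr (Sum.inl z) => if z.2.2.val < n0 then (if z.2.1 = z.2.2 then s else 0)
      else θ (Sum.inr (Sum.inl z))
  | Sum.inr (Sum.inr z) => if h : z.2.val < n0 then s * B z.1 ⟨z.2.val, h⟩ else 0

def dlnE (w n0 : ℕ) : Matrix (Fin w) (Fin n0) ℝ :=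
  Matrix.of fun i j => if i.val = j.val then 1 else 0

theorem mul_dlnE {n0 w : ℕ} (hw : n0 ≤ w) {p : Type} [Fintype p] (M : Matrix p (Fin w) ℝ)
    (i : p) (k : Fin n0) : (M * dlnE w n0) i k = M i (Fin.castLE hw k) := by
  rw [Matrix.mul_apply, Finset.sum_eq_single (Fin.castLE hw k)]
  · simp [dlnE]
  · intro j _ hj
    have : ¬ (j.val = k.val) := fun h => hj (Fin.ext h)
    simp [dlnE, this]
  · simp

theorem dlnTh_mid {n0 nL w L : ℕ} (hw : n0 ≤ w) (θ : DLNParams n0 nL w L) (s : ℝ)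
    (B : Fin nL → Fin n0 → ℝ) (ℓ : Fin (L - 2)) :
    dlnWmid (dlnTh θ s B) ℓ * dlnE w n0 = s • dlnE w n0 := by
  ext i k
  rw [mul_dlnE hw]
  simp only [dlnWmid, Matrix.of_apply, dlnTh, dlnE, Matrix.smul_apply, if_pos k.2, Fin.ext_iff,
    Fin.val_castLE, smul_eq_mul, mul_ite, mul_one, mul_zero]

theorem dlnTh_N {n0 nL w L : ℕ} (hw : n0 ≤ w) (θ : DLNParams n0 nL w L) (s : ℝ)
    (B : Fin nL → Fin n0 → ℝ) :
    dlnN (dlnTh θ s B) = s ^ (L - 2 + 1) • dlnE w n0 := by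
  have h1 : dlnW1 (dlnTh θ s B) = s • dlnE w n0 := by
    ext i j
    simp [dlnW1, dlnTh, dlnE]
  have h2 : ∀ l : List (Fin (L - 2)), (l.map (dlnWmid (dlnTh θ s B))).prod * dlnE w n0
      = s ^ l.length • dlnE w n0 := by
    intro l
    induction l with
    | nil => simp
    | cons a l ih =>
      rw [List.map_cons, List.prod_cons, Matrix.mul_assoc, ih, Matrix.mul_smul, dlnTh_mid hw,
        smul_smul, List.length_cons, pow_succ]
  unfold dlnN
  rw [h1, list_ofFn_rev, Matrix.mul_smul, h2, smul_smul, List.length_reverse,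
    List.length_finRange, pow_succ, mul_comm]

theorem dlnTh_matrix {n0 nL w L : ℕ} (hw : n0 ≤ w) (θ : DLNParams n0 nL w L) (s : ℝ)
    (B : Fin nL → Fin n0 → ℝ) :
    dlnMatrix (dlnTh θ s B) = s ^ (L - 2 + 2) • B := by
  ext i j
  have h : dlnMatrix (dlnTh θ s B) i j = (dlnWL (dlnTh θ s B) * dlnN (dlnTh θ s B)) i j := by
    rw [dlnMatrix_eq, Matrix.mul_apply]; rfl
  rw [h, dlnTh_N hw, Matrix.mul_smul, Matrix.smul_apply, mul_dlnE hw]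
  simp only [dlnWL, Matrix.of_apply, dlnTh, dif_pos j.2, smul_eq_mul, Pi.smul_apply,
    Fin.val_castLE, Fin.eta]
  ring

theorem dlnTh_zero_sum {n0 nL w L : ℕ} (θ : DLNParams n0 nL w L) (B : Fin nL → Fin n0 → ℝ) :
    ∑ i, (θ i - dlnTh θ 0 B i) ^ 2 = ∑ i, dlnMask i * θ i ^ 2 := by
  refine Finset.sum_congr rfl fun i _ => ?_
  rcases i with z | z | z
  · simp [dlnTh, dlnMask]
  · by_cases h : z.2.2.val < n0 <;> simp [dlnTh, dlnMask, h]
  · simp [dlnTh, dlnMask]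

theorem dlnTh_sum {n0 nL w L : ℕ} (θ : DLNParams n0 nL w L) (B : Fin nL → Fin n0 → ℝ)
    (b : ℝ) (hb : ∀ i j, (B i j) ^ 2 ≤ b) (hb0 : 0 ≤ b) :
    ∑ i, (θ i - dlnTh θ 1 B i) ^ 2 ≤ 2 * ∑ i, dlnMask i * θ i ^ 2
      + 2 * (n0 + (L - 2 : ℕ) * n0 + nL * (n0 * b)) := by
  have h1 : ∀ i, (θ i - dlnTh θ 1 B i) ^ 2 ≤
      2 * (dlnMask i * θ i ^ 2) + 2 * (dlnMask i * dlnTh θ 1 B i ^ 2) := by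
    intro i
    rcases i with z | z | z
    · simp only [dlnMask]; nlinarith [sq_nonneg (θ (Sum.inl z) + dlnTh θ 1 B (Sum.inl z))]
    · by_cases h : z.2.2.val < n0
      · simp only [dlnMask, if_pos h]
        nlinarith [sq_nonneg (θ (Sum.inr (Sum.inl z)) + dlnTh θ 1 B (Sum.inr (Sum.inl z)))]
      · simp [dlnMask, h, dlnTh]
    · simp only [dlnMask]
      nlinarith [sq_nonneg (θ (Sum.inr (Sum.inr z)) + dlnTh θ 1 B (Sum.inr (Sum.inr z)))]
  refine (Finset.sum_le_sum fun i _ => h1 i).trans ?_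
  rw [Finset.sum_add_distrib, ← Finset.mul_sum, ← Finset.mul_sum]
  gcongr
  rw [Fintype.sum_sum_type, Fintype.sum_sum_type]
  have g1 : ∑ z : Fin w × Fin n0, dlnMask (Sum.inl z : DLNIdx n0 nL w L) *
      dlnTh θ 1 B (Sum.inl z) ^ 2 ≤ n0 := by
    rw [Fintype.sum_prod_type_right]
    calc _ ≤ ∑ _j : Fin n0, (1 : ℝ) := ?_
      _ = n0 := by simp
    refine Finset.sum_le_sum fun j _ => ?_
    by_cases h : j.val < w
    · rw [Finset.sum_eq_single ⟨j.val, h⟩]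
      · simp [dlnMask, dlnTh]
      · intro i _ hi
        have : ¬ (i.val = j.val) := fun h' => hi (Fin.ext h')
        simp [dlnTh, this]
      · simp
    · rw [Finset.sum_eq_zero]
      · norm_num
      · intro i _
        have : ¬ (i.val = j.val) := fun h' => h (h' ▸ i.2)
        simp [dlnTh, this]
  have g2 : ∑ z : Fin (L - 2) × Fin w × Fin w, dlnMask (Sum.inr (Sum.inl z) : DLNIdx n0 nL w L) *
      dlnTh θ 1 B (Sum.inr (Sum.inl z)) ^ 2 ≤ (L - 2 : ℕ) * n0 := by
    rw [Fintype.sum_prod_type]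
    calc _ ≤ ∑ _j : Fin (L - 2), (n0 : ℝ) := ?_
      _ = _ := by simp
    refine Finset.sum_le_sum fun l _ => ?_
    rw [Fintype.sum_prod_type_right]
    calc _ ≤ ∑ j : Fin w, (if j.val < n0 then (1 : ℝ) else 0) := ?_
      _ ≤ n0 * 1 := mask_card n0 w 1 (by norm_num)
      _ = n0 := mul_one _
    refine Finset.sum_le_sum fun j _ => ?_
    by_cases h : j.val < n0
    · rw [if_pos h, Finset.sum_eq_single j]
      · simp [dlnMask, dlnTh, h]
      · intro i _ hi
        simp [dlnTh, h, hi]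
      · simp
    · rw [if_neg h, Finset.sum_eq_zero]
      intro i _
      simp [dlnMask, h]
  have g3 : ∑ z : Fin nL × Fin w, dlnMask (Sum.inr (Sum.inr z) : DLNIdx n0 nL w L) *
      dlnTh θ 1 B (Sum.inr (Sum.inr z)) ^ 2 ≤ nL * (n0 * b) := by
    rw [Fintype.sum_prod_type]
    calc _ ≤ ∑ _j : Fin nL, ((n0 : ℝ) * b) := ?_
      _ = _ := by simp
    refine Finset.sum_le_sum fun l _ => ?_
    calc _ ≤ ∑ j : Fin w, (if j.val < n0 then b else 0) := ?_
      _ ≤ n0 * b := mask_card n0 w b hb0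
    refine Finset.sum_le_sum fun j _ => ?_
    by_cases h : j.val < n0
    · simp [dlnMask, dlnTh, h, hb]
    · simp [dlnMask, dlnTh, h]
  linarith

theorem diff_dlnMatrix {n0 nL w L : ℕ} :
    Differentiable ℝ (fun θ : DLNParams n0 nL w L => dlnMatrix θ) := by
  have h := fun i j => diff_dlnN (n0 := n0) (nL := nL) (w := w) (L := L) i j
  rw [differentiable_pi]; intro i
  rw [differentiable_pi]; intro j
  simp only [dlnMatrix_eq]
  fun_prop

theorem crit_of_zero {n0 nL w L : ℕ} (C : (Fin nL → Fin n0 → ℝ) → ℝ) (hC : Differentiable ℝ C)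
    (θ : DLNParams n0 nL w L) (hN : dlnN θ = 0) (hW : dlnWL θ = 0) :
    fderiv ℝ (dlnLoss C) θ = 0 := by
  have h1 : HasFDerivAt (fun θ : DLNParams n0 nL w L => dlnMatrix θ)
      (0 : DLNParams n0 nL w L →L[ℝ] (Fin nL → Fin n0 → ℝ)) θ := by
    rw [hasFDerivAt_pi']; intro i
    rw [hasFDerivAt_pi']; intro j
    simp only [dlnMatrix_eq]
    have h2 : ∀ k ∈ (Finset.univ : Finset (Fin w)), HasFDerivAt (fun θ : DLNParams n0 nL w L =>
        θ (Sum.inr (Sum.inr (i, k))) * dlnN θ k j)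
        (0 : DLNParams n0 nL w L →L[ℝ] ℝ) θ := by
      intro k _
      have a := (hasFDerivAt_apply (𝕜 := ℝ) (Sum.inr (Sum.inr (i, k)) : DLNIdx n0 nL w L) θ).mul
        ((diff_dlnN (n0 := n0) (nL := nL) (w := w) (L := L) k j) θ).hasFDerivAt
      have z1 : dlnN θ k j = 0 := by rw [hN]; rfl
      have z2 : θ (Sum.inr (Sum.inr (i, k))) = 0 := congrFun (congrFun hW i) k
      rw [z1, z2, zero_smul, zero_smul, add_zero] at a
      exact a
    have := HasFDerivAt.fun_sum h2
    convert this using 1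
    ext; simp
  have h3 := ((hC (dlnMatrix θ)).hasFDerivAt.comp θ h1).fderiv
  have h4 : dlnLoss (w := w) (L := L) C = C ∘ fun θ => dlnMatrix θ := rfl
  rw [h4, h3, ContinuousLinearMap.comp_zero]

theorem convex_strict {n0 nL : ℕ} (C : (Fin nL → Fin n0 → ℝ) → ℝ)
    (hconv : ConvexOn ℝ Set.univ C) (A : Fin nL → Fin n0 → ℝ) (hA : C A < C 0) (t : ℝ)
    (ht : 0 < t) (ht1 : t ≤ 1) : C (t • A) < C 0 := by
  have h := hconv.2 (Set.mem_univ A) (Set.mem_univ 0) ht.le (sub_nonneg.mpr ht1) (by ring)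
  rw [smul_zero, add_zero, smul_eq_mul, smul_eq_mul] at h
  nlinarith

theorem dlnTh_saddle {n0 nL w L : ℕ} (hw : n0 ≤ w) (C : (Fin nL → Fin n0 → ℝ) → ℝ)
    (hconv : ConvexOn ℝ Set.univ C) (hC : Differentiable ℝ C)
    (A : Fin nL → Fin n0 → ℝ) (hA : C A < C 0) (θ : DLNParams n0 nL w L) :
    DLNIsSaddle C (dlnTh θ 0 A) := by
  refine ⟨crit_of_zero C hC _ ?_ ?_, ?_⟩
  · rw [dlnTh_N hw]; simp
  · ext i j; simp [dlnWL, dlnTh]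
  · intro hmin
    have hcont : Continuous fun s : ℝ => dlnTh θ s A := by
      apply continuous_pi
      intro i
      rcases i with z | z | z
      · simp only [dlnTh]; split_ifs <;> fun_prop
      · simp only [dlnTh]; split_ifs <;> fun_prop
      · simp only [dlnTh]; split_ifs <;> fun_prop
    have h1 : ∀ᶠ s in nhds (0 : ℝ), dlnLoss C (dlnTh θ 0 A) ≤ dlnLoss C (dlnTh θ s A) :=
      (hcont.tendsto 0).eventually hmin
    obtain ⟨δ, hδ, h2⟩ := Metric.eventually_nhds_iff.mp h1
    have h3 := h2 (y := min (δ / 2) 1) (by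
      rw [Real.dist_eq, sub_zero, abs_of_pos (by positivity)]
      exact (min_le_left _ _).trans_lt (by linarith))
    unfold dlnLoss at h3
    rw [dlnTh_matrix hw, dlnTh_matrix hw, zero_pow (by omega), zero_smul] at h3
    have h4 := convex_strict C hconv A hA ((min (δ / 2) 1) ^ (L - 2 + 2)) (by positivity)
      (pow_le_one₀ (by positivity) (min_le_right _ _))
    linarith

section norms
open scoped Matrix.Norms.L2Operator

theorem sum_mulVec_sq_le {m n : ℕ} (A : Matrix (Fin m) (Fin n) ℝ) (x : Fin n → ℝ) :
    ∑ i, (A.mulVec x i) ^ 2 ≤ ‖A‖ ^ 2 * ∑ j, x j ^ 2 := by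
  have h := Matrix.l2_opNorm_mulVec A (WithLp.toLp 2 x)
  have h2 := pow_le_pow_left₀ (norm_nonneg _) h 2
  rw [mul_pow, EuclideanSpace.real_norm_sq_eq, EuclideanSpace.real_norm_sq_eq] at h2
  exact h2

theorem entry_le_opnorm {m n : ℕ} (A : Matrix (Fin m) (Fin n) ℝ) (i : Fin m) (j : Fin n) :
    |A i j| ≤ ‖A‖ := by
  have h := sum_mulVec_sq_le A (Pi.single j 1)
  simp only [Matrix.mulVec_single_one, Matrix.col_apply] at h
  have h1 : ∑ k, (Pi.single j (1 : ℝ) : Fin n → ℝ) k ^ 2 = 1 := by simp [Pi.single_apply]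
  rw [h1, mul_one] at h
  have h2 : A i j ^ 2 ≤ ∑ i, A i j ^ 2 :=
    Finset.single_le_sum (f := fun i => A i j ^ 2) (fun _ _ => sq_nonneg _) (Finset.mem_univ i)
  exact abs_le_of_sq_le_sq (h2.trans h) (norm_nonneg _)

theorem opnorm_le_frob {m n : ℕ} (A : Matrix (Fin m) (Fin n) ℝ) (d : ℝ) (hd : 0 ≤ d)
    (h : ∑ z : Fin m × Fin n, A z.1 z.2 ^ 2 ≤ d ^ 2) : ‖A‖ ≤ d := by
  rw [Matrix.l2_opNorm_def]
  refine ContinuousLinearMap.opNorm_le_bound _ hd fun x => ?_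
  apply le_of_sq_le_sq _ (by positivity)
  rw [mul_pow, EuclideanSpace.real_norm_sq_eq, EuclideanSpace.real_norm_sq_eq]
  have e : ∀ i, ((Matrix.toEuclideanLin ≪≫ₗ LinearMap.toContinuousLinearMap) A x) i
      = ∑ j, A i j * x j := fun i => rfl
  simp_rw [e]
  calc ∑ i, (∑ j, A i j * x j) ^ 2 ≤ ∑ i, ((∑ j, A i j ^ 2) * ∑ j, x j ^ 2) :=
        Finset.sum_le_sum fun i _ => Finset.sum_mul_sq_le_sq_mul_sq _ _ _
    _ = (∑ z : Fin m × Fin n, A z.1 z.2 ^ 2) * ∑ j, x j ^ 2 := by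
        rw [← Finset.sum_mul, Fintype.sum_prod_type]
    _ ≤ _ := by gcongr

theorem norm_one_le (w : ℕ) : ‖(1 : Matrix (Fin w) (Fin w) ℝ)‖ ≤ 1 := by
  rw [Matrix.l2_opNorm_def]
  refine ContinuousLinearMap.opNorm_le_bound _ zero_le_one fun x => ?_
  have : (Matrix.toEuclideanLin ≪≫ₗ LinearMap.toContinuousLinearMap)
      (1 : Matrix (Fin w) (Fin w) ℝ) x = x := by
    simp
  rw [this, one_mul]

theorem listprod_norm {w m : ℕ} (M : Fin m → Matrix (Fin w) (Fin w) ℝ) (a : ℝ) (ha : 0 ≤ a)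
    (h : ∀ i, ‖M i‖ ≤ a) (l : List (Fin m)) : ‖(l.map M).prod‖ ≤ a ^ l.length := by
  induction l with
  | nil => simpa using norm_one_le w
  | cons i l ih =>
    rw [List.map_cons, List.prod_cons, List.length_cons, pow_succ']
    exact (Matrix.l2_opNorm_mul _ _).trans
      (mul_le_mul (h i) ih (norm_nonneg _) ha)

theorem step_norm {p q r : ℕ} (M M' : Matrix (Fin p) (Fin q) ℝ) (P P' : Matrix (Fin q) (Fin r) ℝ)
    (a d b c : ℝ) (ha : ‖M‖ ≤ a) (hd : ‖M' - M‖ ≤ d) (hb : ‖P'‖ ≤ b) (hc : ‖P' - P‖ ≤ c) :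
    ‖M' * P' - M * P‖ ≤ d * b + a * c := by
  have e : M' * P' - M * P = (M' - M) * P' + M * (P' - P) := by
    rw [Matrix.sub_mul, Matrix.mul_sub]; abel
  rw [e]
  refine (norm_add_le _ _).trans (add_le_add ?_ ?_)
  · exact (Matrix.l2_opNorm_mul _ _).trans
      (mul_le_mul hd hb (norm_nonneg _) ((norm_nonneg _).trans hd))
  · exact (Matrix.l2_opNorm_mul _ _).trans
      (mul_le_mul ha hc (norm_nonneg _) ((norm_nonneg _).trans ha))

theorem listprod_diff {w m : ℕ} (M M' : Fin m → Matrix (Fin w) (Fin w) ℝ) (a d : ℝ) (ha : 0 ≤ a)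
    (hd : 0 ≤ d) (h : ∀ i, ‖M i‖ ≤ a) (h' : ∀ i, ‖M' i - M i‖ ≤ d) (l : List (Fin m)) :
    ‖(l.map M').prod - (l.map M).prod‖ ≤ (a + d) ^ l.length - a ^ l.length := by
  have h'' : ∀ i, ‖M' i‖ ≤ a + d := by
    intro i
    have : M' i = M i + (M' i - M i) := by abel
    rw [this]
    exact (norm_add_le _ _).trans (add_le_add (h i) (h' i))
  induction l with
  | nil => simp
  | cons i l ih =>
    rw [List.map_cons, List.prod_cons, List.map_cons, List.prod_cons, List.length_cons]
    refine (step_norm _ _ _ _ a d _ _ (h i) (h' i)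
      (listprod_norm M' (a + d) (by positivity) h'' l) ih).trans (le_of_eq ?_)
    ring

theorem dist_parts {n0 nL w L : ℕ} (θ θ' : DLNParams n0 nL w L) (d : ℝ) (hd : 0 ≤ d)
    (h : dlnDist θ θ' ≤ d) : ‖dlnW1 θ' - dlnW1 θ‖ ≤ d ∧ (∀ ℓ, ‖dlnWmid θ' ℓ - dlnWmid θ ℓ‖ ≤ d) ∧
      ‖dlnWL θ' - dlnWL θ‖ ≤ d := by
  have hs : ∑ i, (θ i - θ' i) ^ 2 ≤ d ^ 2 := by
    have := (Real.sqrt_le_left hd).mp h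
    exact this
  have key : ∀ {κ : Type} [Fintype κ] (e : κ → DLNIdx n0 nL w L), Function.Injective e →
      ∑ k, (θ' (e k) - θ (e k)) ^ 2 ≤ d ^ 2 := by
    intro κ _ e he
    refine le_trans ?_ hs
    calc ∑ k, (θ' (e k) - θ (e k)) ^ 2 = ∑ k, (θ (e k) - θ' (e k)) ^ 2 :=
          Finset.sum_congr rfl fun k _ => by ring
      _ = ∑ i ∈ Finset.univ.map ⟨e, he⟩, (θ i - θ' i) ^ 2 := by rw [Finset.sum_map]; rfl
      _ ≤ _ := Finset.sum_le_sum_of_subset_of_nonneg (Finset.subset_univ _)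
          fun _ _ _ => sq_nonneg _
  refine ⟨opnorm_le_frob _ d hd ?_, fun ℓ => opnorm_le_frob _ d hd ?_, opnorm_le_frob _ d hd ?_⟩
  · exact key (fun z => Sum.inl z) Sum.inl_injective
  · exact key (fun z => Sum.inr (Sum.inl (ℓ, z))) (by intro a b h; simpa using h)
  · exact key (fun z => Sum.inr (Sum.inr z)) (by intro a b h; simpa using h)

theorem good_parts {n0 nL w L : ℕ} (θ : DLNParams n0 nL w L) (K ρ : ℝ) (hK : 0 ≤ K) (hρ : 0 ≤ ρ)
    (h : DLNGood K ρ θ) : ‖dlnW1 θ‖ ≤ K * Real.sqrt ρ ∧ (∀ ℓ, ‖dlnWmid θ ℓ‖ ≤ K * Real.sqrt ρ) ∧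
      ‖dlnWL θ‖ ≤ K * Real.sqrt ρ := by
  have hsq : (K * Real.sqrt ρ) ^ 2 = K ^ 2 * ρ := by rw [mul_pow, Real.sq_sqrt hρ]
  have key : ∀ {κ : Type} [Fintype κ] (e : κ → DLNIdx n0 nL w L), Function.Injective e →
      (∀ k, dlnMask (e k) = 1) → ∑ k, (θ (e k)) ^ 2 ≤ (K * Real.sqrt ρ) ^ 2 := by
    intro κ _ e he h1
    rw [hsq]
    refine le_trans ?_ h.2.1
    calc ∑ k, (θ (e k)) ^ 2 = ∑ k, dlnMask (e k) * (θ (e k)) ^ 2 :=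
          Finset.sum_congr rfl fun k _ => by rw [h1, one_mul]
      _ = ∑ i ∈ Finset.univ.map ⟨e, he⟩, dlnMask i * (θ i) ^ 2 := by rw [Finset.sum_map]; rfl
      _ ≤ _ := Finset.sum_le_sum_of_subset_of_nonneg (Finset.subset_univ _)
          fun i _ _ => mul_nonneg (dlnMask_nonneg i) (sq_nonneg _)
  refine ⟨opnorm_le_frob _ _ (by positivity) ?_, h.1, opnorm_le_frob _ _ (by positivity) ?_⟩
  · exact key (fun z => Sum.inl z) Sum.inl_injective fun _ => rfl
  · exact key (fun z => Sum.inr (Sum.inr z)) (by intro a b h; simpa using h) fun _ => rfl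

theorem le_add_of_sub {p q : ℕ} (M M' : Matrix (Fin p) (Fin q) ℝ) (a d : ℝ) (h : ‖M‖ ≤ a)
    (h' : ‖M' - M‖ ≤ d) : ‖M'‖ ≤ a + d := by
  have : M' = M + (M' - M) := by abel
  rw [this]
  exact (norm_add_le _ _).trans (add_le_add h h')

theorem dlnMatrix_near {n0 nL w L : ℕ} (θ θ' : DLNParams n0 nL w L) (K ρ d : ℝ) (hK : 0 ≤ K)
    (hρ : 0 ≤ ρ) (hd : 0 ≤ d) (h : DLNGood K ρ θ) (h' : dlnDist θ θ' ≤ d) (i : Fin nL)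
    (j : Fin n0) : |dlnMatrix θ' i j| ≤ (K * Real.sqrt ρ + d) ^ (L - 2 + 2) := by
  obtain ⟨a1, a2, a3⟩ := good_parts θ K ρ hK hρ h
  obtain ⟨b1, b2, b3⟩ := dist_parts θ θ' d hd h'
  have c0 : 0 ≤ K * Real.sqrt ρ + d := by positivity
  have c1 := le_add_of_sub _ _ _ _ a1 b1
  have c3 := le_add_of_sub _ _ _ _ a3 b3
  have c2 := listprod_norm (dlnWmid θ') _ c0 (fun ℓ => le_add_of_sub _ _ _ _ (a2 ℓ) (b2 ℓ))
    (List.finRange (L - 2)).reverse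
  rw [← list_ofFn_rev, List.length_reverse, List.length_finRange] at c2
  have e := entry_le_opnorm (dlnWL θ' * (List.ofFn (dlnWmid θ')).reverse.prod * dlnW1 θ') i j
  refine le_trans e ((Matrix.l2_opNorm_mul _ _).trans ?_)
  calc _ ≤ ((K * Real.sqrt ρ + d) * (K * Real.sqrt ρ + d) ^ (L - 2)) * (K * Real.sqrt ρ + d) := by
        refine mul_le_mul ?_ c1 (norm_nonneg _) (by positivity)
        exact (Matrix.l2_opNorm_mul _ _).trans (mul_le_mul c3 c2 (norm_nonneg _) c0)
    _ = _ := by ring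

theorem dlnN_near {n0 nL w L : ℕ} (θ θ' : DLNParams n0 nL w L) (K ρ d : ℝ) (hK : 0 ≤ K)
    (hρ : 0 ≤ ρ) (hd : 0 ≤ d) (h : DLNGood K ρ θ) (h' : dlnDist θ θ' ≤ d) :
    ‖dlnN θ' - dlnN θ‖ ≤ (K * Real.sqrt ρ + d) ^ (L - 2 + 1) - (K * Real.sqrt ρ) ^ (L - 2 + 1) := by
  obtain ⟨a1, a2, a3⟩ := good_parts θ K ρ hK hρ h
  obtain ⟨b1, b2, b3⟩ := dist_parts θ θ' d hd h'
  have ha : 0 ≤ K * Real.sqrt ρ := by positivity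
  have c1 := le_add_of_sub _ _ _ _ a1 b1
  have c2 := listprod_norm (dlnWmid θ) _ ha a2 (List.finRange (L - 2)).reverse
  have c4 := listprod_diff (dlnWmid θ) (dlnWmid θ') _ d ha hd a2 b2
    (List.finRange (L - 2)).reverse
  rw [← list_ofFn_rev, List.length_reverse, List.length_finRange] at c2
  rw [← list_ofFn_rev, ← list_ofFn_rev, List.length_reverse, List.length_finRange] at c4
  refine (step_norm _ _ _ _ _ _ _ _ c2 c4 c1 b1).trans (le_of_eq ?_)
  ring

theorem dlnN_inj {n0 nL w L : ℕ} (θ θ' : DLNParams n0 nL w L) (K ρ c : ℝ) (hK : 0 ≤ K)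
    (hρ : 0 < ρ) (hc : 0 ≤ c) (hKc : (K + c) ^ (L - 2 + 1) - K ^ (L - 2 + 1) ≤ 1 / 2)
    (h : DLNGood K ρ θ) (h' : dlnDist θ θ' ≤ c * Real.sqrt ρ) (x : Fin n0 → ℝ)
    (hx : (dlnN θ').mulVec x = 0) : x = 0 := by
  have h1 := dlnN_near θ θ' K ρ (c * Real.sqrt ρ) hK hρ.le (by positivity) h h'
  have h2 : ‖dlnN θ' - dlnN θ‖ ≤ 1 / 2 * Real.sqrt ρ ^ (L - 2 + 1) := by
    refine h1.trans ?_
    rw [← add_mul, mul_pow, mul_pow, ← sub_mul]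
    gcongr
  have h3 := sum_mulVec_sq_le (dlnN θ' - dlnN θ) x
  have h4 := gramV_lower (dlnN θ) (ρ ^ (L - 2 + 1)) (by positivity) h.2.2 x
  have h5 : ∑ i, ((dlnN θ' - dlnN θ).mulVec x i) ^ 2 = ∑ i, ((dlnN θ).mulVec x i) ^ 2 := by
    rw [Matrix.sub_mulVec, hx, zero_sub]
    simp
  have h6 : ‖dlnN θ' - dlnN θ‖ ^ 2 ≤ 1 / 4 * ρ ^ (L - 2 + 1) := by
    calc _ ≤ (1 / 2 * Real.sqrt ρ ^ (L - 2 + 1)) ^ 2 := by gcongr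
      _ = 1 / 4 * (Real.sqrt ρ ^ 2) ^ (L - 2 + 1) := by ring
      _ = _ := by rw [Real.sq_sqrt hρ.le]
  have hp : 0 < ρ ^ (L - 2 + 1) := by positivity
  have hS : 0 ≤ ∑ j, x j ^ 2 := by positivity
  have h7 : ∑ j, x j ^ 2 = 0 := by
    rw [h5] at h3
    have : ‖dlnN θ' - dlnN θ‖ ^ 2 * ∑ j, x j ^ 2 ≤ 1 / 4 * ρ ^ (L - 2 + 1) * ∑ j, x j ^ 2 := by
      gcongr
    nlinarith
  rw [Finset.sum_eq_zero_iff_of_nonneg fun _ _ => sq_nonneg _] at h7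
  ext j
  simpa using h7 j (Finset.mem_univ j)
end norms

theorem min_of_inj {n0 nL w L : ℕ} (C : (Fin nL → Fin n0 → ℝ) → ℝ)
    (hconv : ConvexOn ℝ Set.univ C) (hC : Differentiable ℝ C) (θ : DLNParams n0 nL w L)
    (hcrit : fderiv ℝ (dlnLoss C) θ = 0)
    (hinj : ∀ x, (dlnN θ).mulVec x = 0 → x = 0) (B : Fin nL → Fin n0 → ℝ) :
    C (dlnMatrix θ) ≤ C B := by
  obtain ⟨g, hg⟩ := LinearMap.exists_leftInverse_of_injective (Matrix.mulVecLin (dlnN θ))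
    (by rw [LinearMap.ker_eq_bot']; exact hinj)
  set G := LinearMap.toMatrix' g with hG
  have hGN : G * dlnN θ = 1 := by
    have := congrArg LinearMap.toMatrix' hg
    rw [LinearMap.toMatrix'_comp, LinearMap.toMatrix'_id] at this
    rw [← Matrix.toLin'_apply', LinearMap.toMatrix'_toLin'] at this
    exact this
  set D : Matrix (Fin nL) (Fin n0) ℝ := Matrix.of fun i j => B i j - dlnMatrix θ i j with hD
  set H : Matrix (Fin nL) (Fin w) ℝ := D * G with hH
  have hHN : H * dlnN θ = D := by rw [hH, Matrix.mul_assoc, hGN, Matrix.mul_one]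
  set h : DLNParams n0 nL w L := Sum.elim 0 (Sum.elim 0 fun z => H z.1 z.2) with hh
  have hN : ∀ t : ℝ, dlnN (θ + t • h) = dlnN θ := by
    intro t
    have e1 : dlnW1 (θ + t • h) = dlnW1 θ := by ext i j; simp [dlnW1, hh]
    have e2 : dlnWmid (θ + t • h) = dlnWmid θ := by ext l i j; simp [dlnWmid, hh]
    unfold dlnN
    rw [e1, e2]
  have hline : ∀ t : ℝ, dlnMatrix (θ + t • h) = dlnMatrix θ + t • (B - dlnMatrix θ) := by
    intro t
    ext i j
    have : B i j - dlnMatrix θ i j = ∑ k, H i k * dlnN θ k j := by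
      rw [← Matrix.mul_apply, hHN]; rfl
    simp only [Pi.add_apply, Pi.smul_apply, Pi.sub_apply, smul_eq_mul, this]
    rw [dlnMatrix_eq, dlnMatrix_eq, hN, Finset.mul_sum, ← Finset.sum_add_distrib]
    refine Finset.sum_congr rfl fun k _ => ?_
    simp only [Pi.add_apply, Pi.smul_apply, smul_eq_mul, hh, Sum.elim_inr]
    ring
  have hdl : HasFDerivAt (dlnLoss C) (0 : DLNParams n0 nL w L →L[ℝ] ℝ) θ := by
    rw [← hcrit]
    exact (DifferentiableAt.comp θ (hC _) (diff_dlnMatrix θ)).hasFDerivAt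
  have hder : HasDerivAt (fun t : ℝ => C (dlnMatrix θ + t • (B - dlnMatrix θ))) 0 0 := by
    have l1 : HasDerivAt (fun t : ℝ => θ + t • h) h 0 := by
      simpa using ((hasDerivAt_id (0 : ℝ)).smul_const h).const_add θ
    have l2 : HasFDerivAt (dlnLoss C) (0 : DLNParams n0 nL w L →L[ℝ] ℝ) (θ + (0 : ℝ) • h) := by
      simpa using hdl
    have l3 := l2.comp_hasDerivAt (0 : ℝ) l1
    have l4 : (dlnLoss C ∘ fun t : ℝ => θ + t • h)
        = fun t : ℝ => C (dlnMatrix θ + t • (B - dlnMatrix θ)) := by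
      ext t; simp only [Function.comp, dlnLoss, hline]
    rw [l4] at l3
    simpa using l3
  have hcv : ConvexOn ℝ Set.univ (fun t : ℝ => C (dlnMatrix θ + t • (B - dlnMatrix θ))) := by
    refine ⟨convex_univ, fun s _ t _ a b ha hb hab => ?_⟩
    have := hconv.2 (Set.mem_univ (dlnMatrix θ + s • (B - dlnMatrix θ)))
      (Set.mem_univ (dlnMatrix θ + t • (B - dlnMatrix θ))) ha hb hab
    refine le_trans (le_of_eq ?_) this
    apply congrArg C
    have hb' : b = 1 - a := by linarith
    subst hb'
    ext i j
    simp only [smul_eq_mul, Pi.add_apply, Pi.smul_apply, Pi.sub_apply]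
    ring
  have := hcv.le_slope_of_hasDerivAt (Set.mem_univ 0) (Set.mem_univ 1) zero_lt_one hder
  simp [slope_def_field] at this
  exact this

theorem not_saddle_near {n0 nL w L : ℕ} (C : (Fin nL → Fin n0 → ℝ) → ℝ)
    (hconv : ConvexOn ℝ Set.univ C) (hC : Differentiable ℝ C) (θ θ' : DLNParams n0 nL w L)
    (K ρ c : ℝ) (hK : 0 ≤ K)
    (hρ : 0 < ρ) (hc : 0 ≤ c) (hKc : (K + c) ^ (L - 2 + 1) - K ^ (L - 2 + 1) ≤ 1 / 2)
    (h : DLNGood K ρ θ) (hs : DLNIsSaddle C θ') : c * Real.sqrt ρ ≤ dlnDist θ θ' := by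
  by_contra hcon
  refine hs.2 (Filter.Eventually.of_forall fun θ'' => ?_)
  exact min_of_inj C hconv hC θ' hs.1
    (fun x hx => dlnN_inj θ θ' K ρ c hK hρ hc hKc h (not_le.mp hcon).le x hx) _

theorem dm_le {n0 nL w L : ℕ} (C : (Fin nL → Fin n0 → ℝ) → ℝ) (θ θ' : DLNParams n0 nL w L)
    (h : DLNIsGlobalMin C θ') : dlnDm C θ ≤ dlnDist θ θ' :=
  csInf_le ⟨0, by rintro _ ⟨x, _, rfl⟩; exact Real.sqrt_nonneg _⟩ ⟨θ', h, rfl⟩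

theorem ds_le {n0 nL w L : ℕ} (C : (Fin nL → Fin n0 → ℝ) → ℝ) (θ θ' : DLNParams n0 nL w L)
    (h : DLNIsSaddle C θ') : dlnDs C θ ≤ dlnDist θ θ' :=
  csInf_le ⟨0, by rintro _ ⟨x, _, rfl⟩; exact Real.sqrt_nonneg _⟩ ⟨θ', h, rfl⟩

theorem scale_facts (γ : ℝ) (w : ℕ) (hw : 1 ≤ w) :
    0 < Real.toNNReal ((w : ℝ) ^ (-γ)) ∧
    (w : ℝ) * (Real.toNNReal ((w : ℝ) ^ (-γ)) : ℝ) = (w : ℝ) ^ (-(γ - 1)) ∧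
    Real.sqrt ((w : ℝ) ^ (-(γ - 1))) = (w : ℝ) ^ (-(γ - 1) / 2) := by
  have hw0 : (0 : ℝ) < w := by exact_mod_cast hw
  refine ⟨Real.toNNReal_pos.mpr (by positivity), ?_, ?_⟩
  · rw [Real.coe_toNNReal _ (by positivity)]
    nth_rewrite 1 [← Real.rpow_one (w : ℝ)]
    rw [← Real.rpow_add hw0]
    congr 1; ring
  · rw [Real.sqrt_eq_rpow, ← Real.rpow_mul hw0.le]
    congr 1; ring

theorem part_m (L n0 nL : ℕ) (γ : ℝ) (hγ : 1 < γ)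
    (C : (Fin nL → Fin n0 → ℝ) → ℝ) (hdiff : Differentiable ℝ C)
    (hne : {A : Fin nL → Fin n0 → ℝ | ∀ B, C A ≤ C B}.Nonempty)
    (h0 : ¬ (∀ B, C (0 : Fin nL → Fin n0 → ℝ) ≤ C B)) (ε : ℝ) (hε : 0 < ε) :
    ∃ (M : ℝ) (w₀ : ℕ), ∀ w : ℕ, w₀ ≤ w →
        dlnGauss n0 nL w L ((w : ℝ) ^ (-γ))
            {θ | dlnDm C θ > M * 1} < ENNReal.ofReal ε ∧
        dlnGauss n0 nL w L ((w : ℝ) ^ (-γ))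
            {θ | (1 : ℝ) > M * dlnDm C θ} < ENNReal.ofReal ε := by
  obtain ⟨K, hK, w1, hw1, hgood⟩ := good_prob n0 nL L ε hε
  obtain ⟨A, hA⟩ := hne
  push Not at h0
  obtain ⟨B, hB⟩ := h0
  obtain ⟨δ, hδ, hball⟩ : ∃ δ > 0, ∀ X : Fin nL → Fin n0 → ℝ, dist X 0 < δ → C B < C X :=
    Metric.eventually_nhds_iff.mp ((hdiff.continuous.tendsto 0).eventually (lt_mem_nhds hB))
  set c : ℝ := min 1 δ / 4 with hc
  have hc0 : 0 < c := by positivity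
  have ht : Filter.Tendsto (fun w : ℕ => K * (w : ℝ) ^ (-(γ - 1) / 2)) Filter.atTop (nhds 0) := by
    have h1 : Filter.Tendsto (fun x : ℝ => x ^ (-((γ - 1) / 2))) Filter.atTop (nhds 0) :=
      tendsto_rpow_neg_atTop (by linarith)
    have h2 := (h1.comp tendsto_natCast_atTop_atTop).const_mul K
    rw [mul_zero] at h2
    refine h2.congr fun w => ?_
    simp only [Function.comp]
    congr 2; ring
  obtain ⟨w2, hw2⟩ := Filter.eventually_atTop.mp (ht.eventually (gt_mem_nhds hc0))
  set b : ℝ := ∑ i, ∑ j, A i j ^ 2 with hb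
  have hb1 : ∀ i j, A i j ^ 2 ≤ b := by
    intro i j
    calc A i j ^ 2 ≤ ∑ j, A i j ^ 2 :=
          Finset.single_le_sum (f := fun j => A i j ^ 2) (fun _ _ => sq_nonneg _)
            (Finset.mem_univ j)
      _ ≤ _ := Finset.single_le_sum (f := fun i => ∑ j, A i j ^ 2)
            (fun _ _ => Finset.sum_nonneg fun _ _ => sq_nonneg _) (Finset.mem_univ i)
  have hb0 : 0 ≤ b := by positivity
  set D : ℝ := 2 * K ^ 2 + 2 * (n0 + (L - 2 : ℕ) * n0 + nL * (n0 * b)) with hD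
  refine ⟨max (Real.sqrt D) (1 / c), max w1 (max n0 w2), fun w hw => ?_⟩
  have hww1 : w1 ≤ w := (le_max_left _ _).trans hw
  have hwn : n0 ≤ w := (le_max_left _ _).trans ((le_max_right _ _).trans hw)
  have hww2 := hw2 w ((le_max_right _ _).trans ((le_max_right _ _).trans hw))
  have hw1' : 1 ≤ w := hw1.trans hww1
  obtain ⟨s1, s2, s3⟩ := scale_facts γ w hw1'
  have hg := hgood w hww1 _ s1
  rw [s2] at hg
  set ρ : ℝ := (w : ℝ) ^ (-(γ - 1)) with hρ
  have hw0 : (1 : ℝ) ≤ w := by exact_mod_cast hw1'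
  have hρ0 : 0 < ρ := by positivity
  have hρ1 : ρ ≤ 1 := Real.rpow_le_one_of_one_le_of_nonpos hw0 (by linarith)
  rw [← s3] at hww2
  have up : ∀ θ : DLNParams n0 nL w L, DLNGood K ρ θ → dlnDm C θ ≤ Real.sqrt D := by
    intro θ hθ
    refine (dm_le C θ (dlnTh θ 1 A) ?_).trans ?_
    · intro X
      rw [dlnTh_matrix hwn, one_pow, one_smul]
      exact hA X
    · apply Real.sqrt_le_sqrt
      refine (dlnTh_sum θ A b hb1 hb0).trans ?_
      have := hθ.2.1
      have : K ^ 2 * ρ ≤ K ^ 2 * 1 := by gcongr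
      rw [hD]
      linarith
  have low : ∀ θ : DLNParams n0 nL w L, DLNGood K ρ θ → c ≤ dlnDm C θ := by
    intro θ hθ
    apply le_csInf
    · refine ⟨_, dlnTh θ 1 A, ?_, rfl⟩
      intro X
      rw [dlnTh_matrix hwn, one_pow, one_smul]
      exact hA X
    · rintro _ ⟨θ', hθ', rfl⟩
      by_contra hcon
      have hcon' : dlnDist θ θ' ≤ c := (not_le.mp hcon).le
      have e := dlnMatrix_near θ θ' K ρ c (by linarith) hρ0.le hc0.le hθ hcon'
      have hlt : dist (dlnMatrix θ') 0 < δ := by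
        have h2c : 2 * c ≤ 1 := by
          have := min_le_left 1 δ
          rw [hc]; linarith
        have h2d : 2 * c < δ := by
          have := min_le_right 1 δ
          rw [hc]; linarith
        have hbd : ∀ i j, |dlnMatrix θ' i j| ≤ 2 * c := by
          intro i j
          refine (e i j).trans ?_
          have hk0 : 0 ≤ K * Real.sqrt ρ := by positivity
          calc (K * Real.sqrt ρ + c) ^ (L - 2 + 2) ≤ (2 * c) ^ (L - 2 + 2) := by
                gcongr; linarith
            _ ≤ (2 * c) ^ 1 := pow_le_pow_of_le_one (by positivity) h2c (by omega)
            _ = 2 * c := pow_one _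
        refine lt_of_le_of_lt ?_ h2d
        rw [dist_zero_right, pi_norm_le_iff_of_nonneg (by positivity)]
        intro i
        rw [pi_norm_le_iff_of_nonneg (by positivity)]
        intro j
        exact hbd i j
      have := hball _ hlt
      have := hθ' B
      linarith
  constructor
  · refine lt_of_le_of_lt (measure_mono fun θ hθ => ?_) hg
    intro hcon
    have h1 := up θ hcon
    have h2 : dlnDm C θ > max (Real.sqrt D) (1 / c) * 1 := hθ
    have h3 := le_max_left (Real.sqrt D) (1 / c)
    linarith
  · refine lt_of_le_of_lt (measure_mono fun θ hθ => ?_) hg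
    intro hcon
    have h1 := low θ hcon
    have h2 : (1 : ℝ) > max (Real.sqrt D) (1 / c) * dlnDm C θ := hθ
    have h3 : 1 / c * c ≤ max (Real.sqrt D) (1 / c) * dlnDm C θ :=
      mul_le_mul (le_max_right _ _) h1 hc0.le ((by positivity : (0 : ℝ) ≤ 1 / c).trans
        (le_max_right _ _))
    rw [show 1 / c * c = 1 by field_simp] at h3
    linarith

theorem part_s (L n0 nL : ℕ) (γ : ℝ)
    (C : (Fin nL → Fin n0 → ℝ) → ℝ) (hconv : ConvexOn ℝ Set.univ C) (hdiff : Differentiable ℝ C)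
    (h0 : ¬ (∀ B, C (0 : Fin nL → Fin n0 → ℝ) ≤ C B)) (ε : ℝ) (hε : 0 < ε) :
    ∃ (M : ℝ) (w₀ : ℕ), ∀ w : ℕ, w₀ ≤ w →
        dlnGauss n0 nL w L ((w : ℝ) ^ (-γ))
            {θ | dlnDs C θ > M * (w : ℝ) ^ (-(γ - 1) / 2)} < ENNReal.ofReal ε ∧
        dlnGauss n0 nL w L ((w : ℝ) ^ (-γ))
            {θ | (w : ℝ) ^ (-(γ - 1) / 2) > M * dlnDs C θ} < ENNReal.ofReal ε := by
  obtain ⟨K, hK, w1, hw1, hgood⟩ := good_prob n0 nL L ε hε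
  push Not at h0
  obtain ⟨B, hB⟩ := h0
  have hK0 : 0 ≤ K := by linarith
  obtain ⟨c, hc0, hKc⟩ : ∃ c : ℝ, 0 < c ∧ (K + c) ^ (L - 2 + 1) - K ^ (L - 2 + 1) ≤ 1 / 2 := by
    have hcont : Continuous fun c : ℝ => (K + c) ^ (L - 2 + 1) - K ^ (L - 2 + 1) := by fun_prop
    have := (hcont.tendsto 0).eventually (gt_mem_nhds
      (show (K + 0) ^ (L - 2 + 1) - K ^ (L - 2 + 1) < 1 / 2 by simp))
    obtain ⟨δ, hδ, h⟩ := Metric.eventually_nhds_iff.mp this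
    refine ⟨δ / 2, by positivity, (h ?_).le⟩
    rw [Real.dist_eq, sub_zero, abs_of_pos (by positivity)]
    linarith
  refine ⟨max K (1 / c), max w1 n0, fun w hw => ?_⟩
  have hww1 : w1 ≤ w := (le_max_left _ _).trans hw
  have hwn : n0 ≤ w := (le_max_right _ _).trans hw
  have hw1' : 1 ≤ w := hw1.trans hww1
  obtain ⟨s1, s2, s3⟩ := scale_facts γ w hw1'
  have hg := hgood w hww1 _ s1
  rw [s2] at hg
  rw [← s3]
  set ρ : ℝ := (w : ℝ) ^ (-(γ - 1)) with hρ
  have hw0 : (1 : ℝ) ≤ w := by exact_mod_cast hw1'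
  have hρ0 : 0 < ρ := by positivity
  have hκ : 0 < Real.sqrt ρ := Real.sqrt_pos.mpr hρ0
  have up : ∀ θ : DLNParams n0 nL w L, DLNGood K ρ θ → dlnDs C θ ≤ K * Real.sqrt ρ := by
    intro θ hθ
    refine (ds_le C θ (dlnTh θ 0 B) (dlnTh_saddle hwn C hconv hdiff B hB θ)).trans ?_
    unfold dlnDist
    rw [dlnTh_zero_sum]
    refine (Real.sqrt_le_sqrt hθ.2.1).trans (le_of_eq ?_)
    rw [Real.sqrt_mul (by positivity), Real.sqrt_sq hK0]
  have low : ∀ θ : DLNParams n0 nL w L, DLNGood K ρ θ → c * Real.sqrt ρ ≤ dlnDs C θ := by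
    intro θ hθ
    apply le_csInf
    · exact ⟨_, dlnTh θ 0 B, dlnTh_saddle hwn C hconv hdiff B hB θ, rfl⟩
    · rintro _ ⟨θ', hθ', rfl⟩
      exact not_saddle_near C hconv hdiff θ θ' K ρ c hK0 hρ0 hc0.le hKc hθ hθ'
  constructor
  · refine lt_of_le_of_lt (measure_mono fun θ hθ => ?_) hg
    intro hcon
    have h1 := up θ hcon
    have h2 : dlnDs C θ > max K (1 / c) * Real.sqrt ρ := hθ
    have h3 : K * Real.sqrt ρ ≤ max K (1 / c) * Real.sqrt ρ :=
      mul_le_mul_of_nonneg_right (le_max_left _ _) hκ.le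
    linarith
  · refine lt_of_le_of_lt (measure_mono fun θ hθ => ?_) hg
    intro hcon
    have h1 := low θ hcon
    have h2 : Real.sqrt ρ > max K (1 / c) * dlnDs C θ := hθ
    have h3 : 1 / c * (c * Real.sqrt ρ) ≤ max K (1 / c) * dlnDs C θ :=
      mul_le_mul (le_max_right _ _) h1 (by positivity) (hK0.trans (le_max_left _ _))
    rw [show 1 / c * (c * Real.sqrt ρ) = Real.sqrt ρ by field_simp] at h3
    linarith

/-- **Distances to critical points at initialization, Saddle-to-Saddle regime (`γ > 1`).**
With i.i.d. `N(0, w^{-γ})` initialization, `d_m ≍ 1` and `d_s ≍ w^{-(γ-1)/2}` as `w → ∞`. -/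
theorem dln_distances_saddle_regime
    (L n0 nL : ℕ) (hL : 2 ≤ L) (γ : ℝ) (hγ : 1 < γ)
    (C : (Fin nL → Fin n0 → ℝ) → ℝ)
    (hconv : ConvexOn ℝ Set.univ C) (hdiff : Differentiable ℝ C)
    (hne : {A : Fin nL → Fin n0 → ℝ | ∀ B, C A ≤ C B}.Nonempty)
    (hnull : volume {A : Fin nL → Fin n0 → ℝ | ∀ B, C A ≤ C B} = 0)
    (h0 : ¬ (∀ B, C (0 : Fin nL → Fin n0 → ℝ) ≤ C B)) :
    (∀ ε : ℝ, 0 < ε → ∃ (M : ℝ) (w₀ : ℕ), ∀ w : ℕ, w₀ ≤ w →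
        dlnGauss n0 nL w L ((w : ℝ) ^ (-γ))
            {θ | dlnDm C θ > M * 1} < ENNReal.ofReal ε ∧
        dlnGauss n0 nL w L ((w : ℝ) ^ (-γ))
            {θ | (1 : ℝ) > M * dlnDm C θ} < ENNReal.ofReal ε) ∧
    (∀ ε : ℝ, 0 < ε → ∃ (M : ℝ) (w₀ : ℕ), ∀ w : ℕ, w₀ ≤ w →
        dlnGauss n0 nL w L ((w : ℝ) ^ (-γ))
            {θ | dlnDs C θ > M * (w : ℝ) ^ (-(γ - 1) / 2)} < ENNReal.ofReal ε ∧
        dlnGauss n0 nL w L ((w : ℝ) ^ (-γ))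
            {θ | (w : ℝ) ^ (-(γ - 1) / 2) > M * dlnDs C θ} < ENNReal.ofReal ε) := by
  exact ⟨fun ε hε => part_m L n0 nL γ hγ C hdiff hne h0 ε hε,
    fun ε hε => part_s L n0 nL γ C hconv hdiff h0 ε hε⟩
end
end

section
/- Let C = H + e be a (2,m)-approximately homogeneous cost with H a 2-homogeneous polynomial. For every s₀ > 2‖H‖_∞/(m−1) there is a unique bijection Ψ : 𝓕_H(s₀) → 𝓕_C(s₀) such that for every path x ∈ 𝓕_H(s₀), ‖x(t) − Ψ(x)(t)‖ = O(e^{(m−1)s₀ t}) as t → −∞. -/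
open Filter Asymptotics

noncomputable section

/-- An escape path of the cost `F` at the saddle `0`: a gradient flow path, defined (as a
solution of the ODE) for all sufficiently negative times, converging to `0` at `-∞`. -/
def IsEscapePath {P : ℕ} (F : EuclideanSpace ℝ (Fin P) → ℝ)
    (x : ℝ → EuclideanSpace ℝ (Fin P)) : Prop :=
  (∃ T : ℝ, ∀ t < T, HasDerivAt x (-(gradient F (x t))) t) ∧
    Tendsto x atBot (nhds 0)

/-- The fast escaping paths of `F` with speed at least `s`, shallow case (`k = 2`):
escape paths with `‖x(t)‖ = O(e^{st})` as `t → -∞`. -/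
def FastPathsShallow {P : ℕ} (F : EuclideanSpace ℝ (Fin P) → ℝ) (s : ℝ) :
    Set (ℝ → EuclideanSpace ℝ (Fin P)) :=
  {x | IsEscapePath F x ∧ (fun t => ‖x t‖) =O[atBot] fun t => Real.exp (s * t)}

/-- The fast escaping paths of `F` with speed at least `s`, deep case (`k > 2`):
escape paths with `‖x(t)‖ ≤ (s (k-2) (T-t))^{-1/(k-2)}` for some `T` and all
sufficiently negative `t`. -/
def FastPathsDeep {P : ℕ} (k : ℕ) (F : EuclideanSpace ℝ (Fin P) → ℝ) (s : ℝ) :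
    Set (ℝ → EuclideanSpace ℝ (Fin P)) :=
  {x | IsEscapePath F x ∧ ∃ T : ℝ, ∀ᶠ t in atBot,
      ‖x t‖ ≤ (s * ((k : ℝ) - 2) * (T - t)) ^ (-(1 / ((k : ℝ) - 2)))}

/-- `‖H‖_∞ = max_{‖x‖=1} |H(x)|`. -/
def supSphere {P : ℕ} (H : EuclideanSpace ℝ (Fin P) → ℝ) : ℝ :=
  sSup ((fun x => |H x|) '' Metric.sphere (0 : EuclideanSpace ℝ (Fin P)) 1)

open MeasureTheory Topology

theorem aux_int {E : Type*} [NormedAddCommGroup E] [NormedSpace ℝ E]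
    {μ B : ℝ} (hμ : 0 < μ) {g : ℝ → E} (hg : Continuous g) (hB : ∀ s, ‖g s‖ ≤ B) (t : ℝ) :
    IntegrableOn (fun s => Real.exp (μ * s) • g s) (Set.Iic t) := by
  refine Integrable.mono' ((integrableOn_exp_mul_Iic hμ t).mul_const B) ?_ ?_
  · exact Continuous.aestronglyMeasurable (by fun_prop)
  · refine Eventually.of_forall fun s => ?_
    rw [norm_smul, Real.norm_eq_abs, abs_of_pos (Real.exp_pos _)]
    exact mul_le_mul_of_nonneg_left (hB s) (Real.exp_pos _).le

theorem aux_bound {E : Type*} [NormedAddCommGroup E] [NormedSpace ℝ E]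
    {μ B : ℝ} (hμ : 0 < μ) {g : ℝ → E} (hB : ∀ s, ‖g s‖ ≤ B) (t : ℝ) :
    ‖∫ s in Set.Iic t, Real.exp (μ * s) • g s‖ ≤ Real.exp (μ * t) * (B / μ) := by
  have h := norm_integral_le_of_norm_le ((integrableOn_exp_mul_Iic hμ t).mul_const B)
    (f := fun s => Real.exp (μ * s) • g s) (μ := volume.restrict (Set.Iic t)) ?_
  · refine h.trans (le_of_eq ?_)
    rw [integral_mul_const, integral_exp_mul_Iic hμ]
    ring
  · refine Eventually.of_forall fun s => ?_
    rw [norm_smul, Real.norm_eq_abs, abs_of_pos (Real.exp_pos _)]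
    exact mul_le_mul_of_nonneg_left (hB s) (Real.exp_pos _).le

theorem aux_deriv {E : Type*} [NormedAddCommGroup E] [NormedSpace ℝ E] [CompleteSpace E]
    {μ B : ℝ} (hμ : 0 < μ) {g : ℝ → E} (hg : Continuous g) (hB : ∀ s, ‖g s‖ ≤ B) (t : ℝ) :
    HasDerivAt (fun t => ∫ s in Set.Iic t, Real.exp (μ * s) • g s) (Real.exp (μ * t) • g t) t := by
  have hc : Continuous (fun s => Real.exp (μ * s) • g s) := by fun_prop
  have h1 : HasDerivAt (fun t => ∫ s in (0:ℝ)..t, Real.exp (μ * s) • g s)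
      (Real.exp (μ * t) • g t) t := hc.integral_hasStrictDerivAt 0 t |>.hasDerivAt
  have h2 := h1.const_add (∫ s in Set.Iic (0:ℝ), Real.exp (μ * s) • g s)
  convert h2 using 1
  ext t
  have := intervalIntegral.integral_Iic_sub_Iic (aux_int hμ hg hB 0) (aux_int hμ hg hB t)
  rw [← this]; abel

open BoundedContinuousFunction in
theorem lemA {E : Type*} [NormedAddCommGroup E] [NormedSpace ℝ E] [CompleteSpace E]
    {μ M K : ℝ} (hK : 0 ≤ K) (hμ : K < μ) (G : ℝ → E → E)
    (hG : Continuous (Function.uncurry G))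
    (hL : ∀ t u v, ‖G t u - G t v‖ ≤ K * ‖u - v‖) (hM : ∀ t, ‖G t 0‖ ≤ M) :
    ∃ u : ℝ → E, (∃ B, ∀ t, ‖u t‖ ≤ B) ∧
      ∀ t, HasDerivAt (fun t => Real.exp (μ * t) • u t) (Real.exp (μ * t) • G t (u t)) t := by
  have hμ0 : 0 < μ := lt_of_le_of_lt hK hμ
  have hgc : ∀ u : ℝ →ᵇ E, Continuous fun s => G s (u s) := fun u =>
    hG.comp (continuous_id.prodMk u.continuous)
  have hgb : ∀ (u : ℝ →ᵇ E) s, ‖G s (u s)‖ ≤ K * ‖u‖ + M := by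
    intro u s
    have h1 := hL s (u s) 0
    have h2 := hM s
    have h3 := mul_le_mul_of_nonneg_left (u.norm_coe_le_norm s) hK
    have h4 : ‖G s (u s)‖ ≤ ‖G s (u s) - G s 0‖ + ‖G s 0‖ := norm_le_norm_sub_add _ _
    rw [sub_zero] at h1
    linarith
  let J : (ℝ →ᵇ E) → ℝ → E := fun u t => ∫ s in Set.Iic t, Real.exp (μ * s) • G s (u s)
  have hJd : ∀ u t, HasDerivAt (J u) (Real.exp (μ * t) • G t (u t)) t := fun u t =>
    aux_deriv hμ0 (hgc u) (hgb u) t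
  have hJc : ∀ u, Continuous (J u) := fun u =>
    continuous_iff_continuousAt.2 fun t => (hJd u t).continuousAt
  have key : ∀ (t : ℝ) (a : E) (c : ℝ), ‖a‖ ≤ Real.exp (μ * t) * c →
      ‖Real.exp (-(μ * t)) • a‖ ≤ c := by
    intro t a c h
    rw [norm_smul, Real.norm_eq_abs, abs_of_pos (Real.exp_pos _)]
    calc _ ≤ Real.exp (-(μ * t)) * (Real.exp (μ * t) * c) :=
          mul_le_mul_of_nonneg_left h (Real.exp_pos _).le
      _ = c := by rw [← mul_assoc, ← Real.exp_add]; simp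
  let Φ : (ℝ →ᵇ E) → (ℝ →ᵇ E) := fun u =>
    BoundedContinuousFunction.ofNormedAddCommGroup (fun t => Real.exp (-(μ * t)) • J u t)
      (by have := hJc u; fun_prop) ((K * ‖u‖ + M) / μ)
      (fun t => key t _ _ (aux_bound hμ0 (hgb u) t))
  have hΦ : ContractingWith (Real.toNNReal (K / μ)) Φ := by
    refine ⟨?_, ?_⟩
    · rw [← NNReal.coe_lt_coe, Real.coe_toNNReal _ (by positivity)]
      exact (div_lt_one hμ0).2 hμ
    · refine LipschitzWith.of_dist_le_mul fun u v => ?_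
      rw [Real.coe_toNNReal _ (by positivity), BoundedContinuousFunction.dist_le (by positivity)]
      intro t
      change dist (Real.exp (-(μ * t)) • J u t) (Real.exp (-(μ * t)) • J v t) ≤ K / μ * dist u v
      rw [dist_eq_norm, ← smul_sub]
      apply key
      have h1 : J u t - J v t = ∫ s in Set.Iic t, Real.exp (μ * s) • (G s (u s) - G s (v s)) := by
        simp only [smul_sub]
        rw [integral_sub (aux_int hμ0 (hgc u) (hgb u) t) (aux_int hμ0 (hgc v) (hgb v) t)]
      rw [h1]
      refine (aux_bound hμ0 (B := K * dist u v) ?_ t).trans (le_of_eq (by ring))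
      intro s
      refine (hL s _ _).trans ?_
      gcongr
      rw [← dist_eq_norm]
      exact BoundedContinuousFunction.dist_coe_le_dist s
  let u := hΦ.fixedPoint
  have hu : Φ u = u := hΦ.fixedPoint_isFixedPt
  refine ⟨u, ⟨‖u‖, u.norm_coe_le_norm⟩, fun t => ?_⟩
  have h2 : (fun t => Real.exp (μ * t) • u t) = J u := by
    ext t
    have : u t = Real.exp (-(μ * t)) • J u t := by
      conv_lhs => rw [← hu]
      rfl
    rw [this, smul_smul, ← Real.exp_add]; simp
  rw [h2]
  exact hJd u t

theorem aux_exp_atBot {s : ℝ} (hs : 0 < s) : Tendsto (fun t => Real.exp (s * t)) atBot (𝓝 0) :=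
  Real.tendsto_exp_atBot.comp (tendsto_id.const_mul_atBot hs)

theorem lemB {E : Type*} [NormedAddCommGroup E] [NormedSpace ℝ E] [CompleteSpace E]
    {μ K : ℝ} (hK : 0 ≤ K) (hμ : K < μ) {V W ρ : E → E}
    (hVW : V =ᶠ[𝓝 0] W) (hW : ∀ u v, ‖W u - W v‖ ≤ K * ‖u - v‖) (hρ : Continuous ρ)
    {x : ℝ → E} (hx0 : Tendsto x atBot (𝓝 0))
    (hx : ∀ᶠ t in atBot, HasDerivAt x (V (x t) + ρ (x t)) t)
    (hr : (fun t => ρ (x t)) =O[atBot] fun t => Real.exp (μ * t)) :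
    ∃ y : ℝ → E, (∀ᶠ t in atBot, HasDerivAt y (V (y t)) t) ∧
      (fun t => x t - y t) =O[atBot] fun t => Real.exp (μ * t) := by
  have hμ0 : 0 < μ := lt_of_le_of_lt hK hμ
  have hWc : Continuous W := by
    have : LipschitzWith K.toNNReal W := LipschitzWith.of_dist_le_mul fun u v => by
      rw [Real.coe_toNNReal _ hK, dist_eq_norm, dist_eq_norm]; exact hW u v
    exact this.continuous
  obtain ⟨M, hM⟩ := hr.bound
  obtain ⟨T, hT⟩ := eventually_atBot.1 ((hM.and hx).and (hx0.eventually hVW))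
  let X : ℝ → E := fun t => x (min t T)
  have hXc : Continuous X := by
    have : ContinuousOn x (Set.Iic T) := fun t ht =>
      ((hT t ht).1.2).continuousAt.continuousWithinAt
    exact this.comp_continuous (by fun_prop) (fun t => Set.mem_Iic.2 (min_le_right _ _))
  let G : ℝ → E → E := fun t u => Real.exp (-(μ * min t T)) •
    (W (X t + Real.exp (μ * min t T) • u) - W (X t) - ρ (X t))
  have hee : ∀ a : ℝ, Real.exp (-a) * Real.exp a = 1 := fun a => by
    rw [← Real.exp_add]; simp
  obtain ⟨u, ⟨B, hB⟩, hu⟩ := lemA (M := M) hK hμ G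
    (by
      change Continuous fun p : ℝ × E => Real.exp (-(μ * min p.1 T)) •
        (W (X p.1 + Real.exp (μ * min p.1 T) • p.2) - W (X p.1) - ρ (X p.1))
      fun_prop)
    (by
      intro t u v
      have h1 : G t u - G t v = Real.exp (-(μ * min t T)) •
        (W (X t + Real.exp (μ * min t T) • u) - W (X t + Real.exp (μ * min t T) • v)) := by
        simp only [G, ← smul_sub]; congr 1; abel
      rw [h1, norm_smul, Real.norm_eq_abs, abs_of_pos (Real.exp_pos _)]
      have h2 := hW (X t + Real.exp (μ * min t T) • u) (X t + Real.exp (μ * min t T) • v)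
      rw [add_sub_add_left_eq_sub, ← smul_sub, norm_smul, Real.norm_eq_abs,
        abs_of_pos (Real.exp_pos _)] at h2
      calc _ ≤ _ := mul_le_mul_of_nonneg_left h2 (Real.exp_pos (-(μ * min t T))).le
        _ = (Real.exp (-(μ * min t T)) * Real.exp (μ * min t T)) * (K * ‖u - v‖) := by ring
        _ = _ := by rw [hee, one_mul])
    (by
      intro t
      have h2 := (hT (min t T) (min_le_right _ _)).1.1
      rw [Real.norm_eq_abs, abs_of_pos (Real.exp_pos _)] at h2
      simp only [G, smul_zero, add_zero, sub_self, zero_sub, norm_smul, norm_neg]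
      rw [Real.norm_eq_abs, abs_of_pos (Real.exp_pos _)]
      calc _ ≤ _ := mul_le_mul_of_nonneg_left h2 (Real.exp_pos (-(μ * min t T))).le
        _ = (Real.exp (-(μ * min t T)) * Real.exp (μ * min t T)) * M := by ring
        _ = _ := by rw [hee, one_mul])
  let y : ℝ → E := fun t => x t + Real.exp (μ * t) • u t
  have hO : (fun t => x t - y t) =O[atBot] fun t => Real.exp (μ * t) := by
    refine IsBigO.of_bound B (Filter.Eventually.of_forall fun t => ?_)
    simp only [y, sub_add_cancel_left, norm_neg, norm_smul]
    rw [mul_comm]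
    exact mul_le_mul_of_nonneg_right (hB t) (norm_nonneg _)
  have hy0 : Tendsto y atBot (𝓝 0) := by
    have h := hO.trans_tendsto (aux_exp_atBot hμ0)
    simpa using hx0.sub h
  refine ⟨y, ?_, hO⟩
  filter_upwards [hy0.eventually hVW, eventually_le_atBot T] with t h1 h2
  rw [h1]
  have h3 := (hT t h2).1.2.add (hu t)
  refine h3.congr_deriv ?_
  rw [(hT t h2).2]
  simp only [G, X, min_eq_left h2, smul_smul, y]
  rw [mul_comm, hee, one_smul]
  abel

theorem lemU {E : Type*} [NormedAddCommGroup E] [NormedSpace ℝ E]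
    {μ K : ℝ} (hμ : K < μ) {V W : E → E}
    (hVW : V =ᶠ[𝓝 0] W) (hW : ∀ u v, ‖W u - W v‖ ≤ K * ‖u - v‖)
    {y z : ℝ → E} (hy0 : Tendsto y atBot (𝓝 0)) (hz0 : Tendsto z atBot (𝓝 0))
    (hy : ∀ᶠ t in atBot, HasDerivAt y (V (y t)) t)
    (hz : ∀ᶠ t in atBot, HasDerivAt z (V (z t)) t)
    (hO : (fun t => y t - z t) =O[atBot] fun t => Real.exp (μ * t)) : y =ᶠ[atBot] z := by
  obtain ⟨M, hM⟩ := hO.bound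
  obtain ⟨T, hT⟩ := eventually_atBot.1 (((hM.and hy).and (hz.and (hy0.eventually hVW))).and
    (hz0.eventually hVW))
  have key : ∀ a t, a ≤ t → t ≤ T →
      ‖y t - z t‖ ≤ M * Real.exp (μ * a) * Real.exp (K * (t - a)) := by
    intro a t hat htT
    have h := norm_le_gronwallBound_of_norm_deriv_right_le (f := fun t => y t - z t)
      (f' := fun t => V (y t) - V (z t)) (δ := M * Real.exp (μ * a)) (K := K) (ε := 0)
      (a := a) (b := t)
      (fun r hr => ((hT r (hr.2.trans htT)).1.1.2.continuousAt.sub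
        (hT r (hr.2.trans htT)).1.2.1.continuousAt).continuousWithinAt)
      (fun r hr => ((hT r (hr.2.le.trans htT)).1.1.2.sub
        (hT r (hr.2.le.trans htT)).1.2.1).hasDerivWithinAt)
      (by simpa using (hT a (hat.trans htT)).1.1.1)
      (fun r hr => by
        rw [(hT r (hr.2.le.trans htT)).1.2.2, (hT r (hr.2.le.trans htT)).2, add_zero]
        exact hW _ _) t ⟨hat, le_rfl⟩
    rwa [gronwallBound_ε0] at h
  filter_upwards [eventually_le_atBot T] with t ht
  have hlim : Tendsto (fun a => M * Real.exp (μ * a) * Real.exp (K * (t - a))) atBot (𝓝 0) := by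
    have h := (aux_exp_atBot (sub_pos.2 hμ)).const_mul (M * Real.exp (K * t))
    rw [mul_zero] at h
    refine h.congr fun a => ?_
    rw [mul_assoc, mul_assoc, ← Real.exp_add, ← Real.exp_add]
    congr 2; ring
  have h0 : ‖y t - z t‖ ≤ 0 := ge_of_tendsto hlim (by
    filter_upwards [eventually_le_atBot t] with a ha using key a t ha ht)
  exact sub_eq_zero.1 (norm_le_zero_iff.1 h0)

theorem lemT (N : ℕ) : ∀ {E F : Type} [NormedAddCommGroup E] [NormedSpace ℝ E]
    [NormedAddCommGroup F] [NormedSpace ℝ F] {f : E → F} (_ : ContDiff ℝ (⊤ : ℕ∞) f)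
    (_ : ∀ n ≤ N, iteratedFDeriv ℝ n f 0 = 0), f =O[𝓝 0] fun x => ‖x‖ ^ (N + 1) := by
  induction N with
  | zero =>
    intro E F _ _ _ _ f hf h
    have h0 : f 0 = 0 := by
      have := h 0 le_rfl
      rw [← norm_eq_zero, norm_iteratedFDeriv_zero, norm_eq_zero] at this
      exact this
    have hd := (hf.differentiable (by simp) 0).isBigO_sub
    simpa [h0] using hd.norm_right
  | succ N ih =>
    intro E F _ _ _ _ f hf h
    have h0 : f 0 = 0 := by
      have := h 0 (Nat.zero_le _)
      rw [← norm_eq_zero, norm_iteratedFDeriv_zero, norm_eq_zero] at this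
      exact this
    have h1 : fderiv ℝ f =O[𝓝 0] fun x => ‖x‖ ^ (N + 1) := by
      refine ih (hf.fderiv_right (by norm_cast)) fun n hn => ?_
      rw [← norm_eq_zero, norm_iteratedFDeriv_fderiv, norm_eq_zero]
      exact h _ (by omega)
    obtain ⟨M, hM0, hM⟩ := h1.exists_nonneg
    obtain ⟨ε, hε, hb⟩ := Metric.eventually_nhds_iff_ball.1 hM.bound
    refine IsBigO.of_bound M ?_
    filter_upwards [Metric.ball_mem_nhds 0 hε] with x hx
    have := Convex.norm_image_sub_le_of_norm_fderiv_le (𝕜 := ℝ) (f := f)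
      (s := Metric.closedBall 0 ‖x‖) (C := M * ‖x‖ ^ (N + 1)) (x := 0) (y := x)
      (fun z _ => hf.differentiable (by simp) z)
      (fun z hz => by
        rw [mem_closedBall_zero_iff] at hz
        have := hb z (by rw [mem_ball_zero_iff] at hx ⊢; linarith)
        refine this.trans ?_
        rw [norm_pow, norm_norm]
        gcongr) (convex_closedBall _ _) (by simp) (by simp)
    rw [h0, sub_zero, sub_zero] at this
    rw [norm_pow, norm_norm]
    refine this.trans (le_of_eq (by ring))

theorem lemH {P : ℕ} {H : EuclideanSpace ℝ (Fin P) → ℝ}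
    (hpoly : ∃ p : MvPolynomial (Fin P) ℝ, ∀ x, H x = MvPolynomial.eval (fun i => x i) p)
    (hhom : ∀ α : ℝ, 0 < α → ∀ θ : EuclideanSpace ℝ (Fin P), H (α • θ) = α ^ 2 * H θ) :
    ContDiff ℝ (⊤ : ℕ∞) H ∧ 0 ≤ supSphere H ∧
      ∀ u v, ‖gradient H u - gradient H v‖ ≤ 2 * supSphere H * ‖u - v‖ := by
  have hsm : ContDiff ℝ (⊤ : ℕ∞) H := by
    obtain ⟨p, hp⟩ := hpoly
    have : H = fun x => MvPolynomial.eval (fun i => x i) p := funext hp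
    rw [this]
    clear this hp
    induction p using MvPolynomial.induction_on with
    | C a => simpa using contDiff_const
    | add p q hp hq =>
      simp only [map_add]
      exact ContDiff.add hp hq
    | mul_X p i hp =>
      simp only [map_mul, MvPolynomial.eval_X]
      exact ContDiff.mul hp (by fun_prop)
  have hS0 : 0 ≤ supSphere H := by
    apply Real.sSup_nonneg
    rintro _ ⟨x, _, rfl⟩
    exact abs_nonneg _
  refine ⟨hsm, hS0, ?_⟩
  have hbdd : BddAbove ((fun x => |H x|) '' Metric.sphere (0 : EuclideanSpace ℝ (Fin P)) 1) :=
    ((isCompact_sphere _ _).image (by have := hsm.continuous; fun_prop)).bddAbove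
  have hH0 : H 0 = 0 := by
    have := hhom 2 (by norm_num) 0
    rw [smul_zero] at this; linarith
  have hHS : ∀ x, |H x| ≤ supSphere H * ‖x‖ ^ 2 := by
    intro x
    by_cases hx : x = 0
    · simp [hx, hH0]
    have hn : 0 < ‖x‖ := norm_pos_iff.2 hx
    have h1 : |H (‖x‖⁻¹ • x)| ≤ supSphere H := le_csSup hbdd ⟨_, by
      simp [norm_smul, hn.ne'], rfl⟩
    have h2 := hhom ‖x‖ hn (‖x‖⁻¹ • x)
    rw [smul_smul, mul_inv_cancel₀ hn.ne', one_smul] at h2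
    rw [h2, abs_mul, abs_of_nonneg (by positivity), mul_comm]
    gcongr
  have hdiff : Differentiable ℝ H := hsm.differentiable (by simp)
  have hfs : ContDiff ℝ (⊤ : ℕ∞) (fderiv ℝ H) := hsm.fderiv_right (by norm_cast)
  have hfh : ∀ α : ℝ, 0 < α → ∀ x, fderiv ℝ H (α • x) = α • fderiv ℝ H x := by
    intro α hα x
    have h1 : fderiv ℝ (fun x => H (α • x)) x = α • fderiv ℝ H (α • x) := by
      rw [fderiv_comp_smul]
    have h2 : (fun x => H (α • x)) = fun x => α ^ 2 • H x := by
      ext x; rw [hhom α hα]; rfl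
    rw [h2, fderiv_fun_const_smul (hdiff x)] at h1
    have h3 : α • (α • fderiv ℝ H x - fderiv ℝ H (α • x)) = 0 := by
      rw [smul_sub, ← h1, smul_smul, pow_two, sub_self]
    exact (sub_eq_zero.1 ((smul_eq_zero.1 h3).resolve_left hα.ne')).symm
  have hf0 : fderiv ℝ H 0 = 0 := by
    have := hfh 2 (by norm_num) 0
    rw [smul_zero, two_smul] at this
    exact left_eq_add.1 this
  set B := fderiv ℝ (fderiv ℝ H) 0 with hBdef
  have hBd : HasFDerivAt (fderiv ℝ H) B 0 := (hfs.differentiable (by simp) 0).hasFDerivAt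
  have hB : ∀ x, fderiv ℝ H x = B x := by
    intro x
    have h1 : HasDerivAt (fun a : ℝ => fderiv ℝ H (a • x)) (B x) 0 := by
      have h2 : HasDerivAt (fun a : ℝ => a • x) x 0 := by
        simpa using (hasDerivAt_id (0:ℝ)).smul_const x
      have h3 : HasFDerivAt (fderiv ℝ H) B ((0:ℝ) • x) := by simpa using hBd
      exact h3.comp_hasDerivAt (0:ℝ) h2
    have h4 : HasDerivWithinAt (fun a : ℝ => fderiv ℝ H (a • x)) (fderiv ℝ H x) (Set.Ici 0) 0 := by
      have h5 : HasDerivWithinAt (fun a : ℝ => a • fderiv ℝ H x) (fderiv ℝ H x) (Set.Ici 0) 0 := by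
        simpa using ((hasDerivAt_id (0:ℝ)).smul_const (fderiv ℝ H x)).hasDerivWithinAt
      refine h5.congr (fun a ha => ?_) (by simp [hf0])
      rcases (Set.mem_Ici.1 ha).eq_or_lt with h | h
      · simp [← h, hf0]
      · exact hfh a h x
    exact (uniqueDiffWithinAt_Ici (0:ℝ)).eq_deriv _ h4 h1.hasDerivWithinAt
  have hsymm : ∀ x y, B x y = B y x :=
    second_derivative_symmetric (fun y => (hdiff y).hasFDerivAt) hBd
  have hBH : ∀ x, B x x = 2 * H x := by
    intro x
    have h1 : HasDerivAt (fun a : ℝ => H (a • x)) (B x x) 1 := by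
      have h2 : HasDerivAt (fun a : ℝ => a • x) x 1 := by
        simpa using (hasDerivAt_id (1:ℝ)).smul_const x
      have h3 : HasFDerivAt H (B x) ((1:ℝ) • x) := by
        rw [one_smul, ← hB]; exact (hdiff x).hasFDerivAt
      exact h3.comp_hasDerivAt (1:ℝ) h2
    have h4 : HasDerivAt (fun a : ℝ => a ^ 2 * H x) (2 * H x) 1 := by
      simpa using (hasDerivAt_pow 2 (1:ℝ)).mul_const (H x)
    have h5 : (fun a : ℝ => H (a • x)) =ᶠ[𝓝 1] fun a : ℝ => a ^ 2 * H x := by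
      filter_upwards [lt_mem_nhds (zero_lt_one (α := ℝ))] with a ha using hhom a ha x
    exact h1.unique (h4.congr_of_eventuallyEq h5)
  have hBn : ‖B‖ ≤ 2 * supSphere H := by
    refine ContinuousLinearMap.opNorm_le_of_unit_norm (by positivity) fun x hx => ?_
    refine ContinuousLinearMap.opNorm_le_of_unit_norm (by positivity) fun y hy => ?_
    have h1 : 4 * B x y = B (x + y) (x + y) - B (x - y) (x - y) := by
      simp only [map_add, map_sub, add_apply, sub_apply]
      rw [hsymm y x]; ring
    rw [hBH, hBH] at h1
    have h2 := abs_le.1 (hHS (x + y))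
    have h3 := abs_le.1 (hHS (x - y))
    have h4 := parallelogram_law_with_norm ℝ x y
    rw [hx, hy] at h4
    have h5 : supSphere H * ‖x + y‖ ^ 2 + supSphere H * ‖x - y‖ ^ 2 = 4 * supSphere H := by
      linear_combination supSphere H * h4
    rw [Real.norm_eq_abs, abs_le]
    constructor <;> linarith [h2.1, h2.2, h3.1, h3.2]
  intro u v
  unfold gradient
  rw [← map_sub, LinearIsometryEquiv.norm_map, hB, hB, ← map_sub]
  exact (B.le_opNorm _).trans (by gcongr)

theorem lemN {P m : ℕ} (hm : 2 < m) {e : EuclideanSpace ℝ (Fin P) → ℝ}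
    (hes : ContDiff ℝ (⊤ : ℕ∞) e)
    (hev : ∀ n : ℕ, n ≤ m - 1 → iteratedFDeriv ℝ n e 0 = 0) :
    Continuous (gradient e) ∧ (gradient e =O[𝓝 0] fun x => ‖x‖ ^ (m - 1)) ∧
      HasStrictFDerivAt (gradient e) (0 : EuclideanSpace ℝ (Fin P) →L[ℝ] _) 0 := by
  have hfs : ContDiff ℝ (⊤ : ℕ∞) (fderiv ℝ e) := hes.fderiv_right (by norm_cast)
  have hgs : ContDiff ℝ (⊤ : ℕ∞) (gradient e) :=
    (InnerProductSpace.toDual ℝ (EuclideanSpace ℝ (Fin P))).symm.contDiff.comp hfs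
  have hO : gradient e =O[𝓝 0] fun x => ‖x‖ ^ (m - 1) := by
    have h1 : fderiv ℝ e =O[𝓝 0] fun x => ‖x‖ ^ (m - 2 + 1) := by
      refine lemT (m - 2) hfs fun n hn => ?_
      rw [← norm_eq_zero, norm_iteratedFDeriv_fderiv, norm_eq_zero]
      exact hev _ (by omega)
    rw [show m - 2 + 1 = m - 1 by omega] at h1
    refine IsBigO.trans (IsBigO.of_bound 1 (Filter.Eventually.of_forall fun x => ?_)) h1
    unfold gradient
    rw [LinearIsometryEquiv.norm_map, one_mul]
  refine ⟨hgs.continuous, hO, ?_⟩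
  have h0 : gradient e 0 = 0 := by
    obtain ⟨c, hc⟩ := hO.bound
    have := hc.self_of_nhds
    rw [norm_zero, zero_pow (by omega), norm_zero, mul_zero] at this
    exact norm_le_zero_iff.1 this
  refine hgs.contDiffAt.hasStrictFDerivAt' (n := (⊤ : ℕ∞)) ?_ (by simp)
  rw [hasFDerivAt_iff_isLittleO_nhds_zero]
  simp only [zero_add, h0, sub_zero, zero_apply]
  refine hO.trans_isLittleO ?_
  have h2 : (fun x : EuclideanSpace ℝ (Fin P) => ‖x‖ ^ (m - 1)) =o[𝓝 0] fun x => ‖x‖ ^ 1 :=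
    (isLittleO_pow_pow (𝕜 := ℝ) (show 1 < m - 1 by omega)).comp_tendsto
      (by simpa using (continuous_norm (E := EuclideanSpace ℝ (Fin P))).tendsto 0)
  simp only [pow_one] at h2
  exact h2.of_norm_right

theorem lemV {P : ℕ} {L μ : ℝ} (hL : 0 ≤ L) (hLμ : L < μ)
    {A N : EuclideanSpace ℝ (Fin P) → EuclideanSpace ℝ (Fin P)}
    (hA : ∀ u v, ‖A u - A v‖ ≤ L * ‖u - v‖)
    (hN : HasStrictFDerivAt N (0 : EuclideanSpace ℝ (Fin P) →L[ℝ] _) 0) :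
    ∃ K, 0 ≤ K ∧ K < μ ∧ ∃ W : EuclideanSpace ℝ (Fin P) → EuclideanSpace ℝ (Fin P),
      (fun x => -(A x + N x)) =ᶠ[𝓝 0] W ∧ ∀ u v, ‖W u - W v‖ ≤ K * ‖u - v‖ := by
  set c := lipschitzExtensionConstant (EuclideanSpace ℝ (Fin P)) with hc
  have hc0 : 0 < (c : ℝ) := lipschitzExtensionConstant_pos _
  have hδ : 0 < (μ - L) / (2 * c) := by
    have := sub_pos.2 hLμ
    positivity
  obtain ⟨s, hs, hlip⟩ := hN.exists_lipschitzOnWith_of_nnnorm_lt (Real.toNNReal ((μ - L) / (2 * c)))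
    (by simpa using hδ)
  obtain ⟨g, hg, hgs⟩ := hlip.extend_finite_dimension
  refine ⟨L + (μ - L) / 2, by linarith, by linarith, fun x => -(A x + g x), ?_, ?_⟩
  · filter_upwards [hs] with x hx
    rw [hgs hx]
  · intro u v
    have h1 := hA u v
    have h2 := hg.dist_le_mul u v
    rw [NNReal.coe_mul, Real.coe_toNNReal _ hδ.le, dist_eq_norm, dist_eq_norm, ← hc] at h2
    have h3 : (c : ℝ) * ((μ - L) / (2 * c)) = (μ - L) / 2 := by field_simp
    rw [h3] at h2
    have h4 : -(A u + g u) - -(A v + g v) = -((A u - A v) + (g u - g v)) := by abel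
    rw [h4, norm_neg]
    refine (norm_add_le _ _).trans ?_
    linarith

theorem fast_iff {P : ℕ} {F : EuclideanSpace ℝ (Fin P) → ℝ} {s : ℝ}
    {x : ℝ → EuclideanSpace ℝ (Fin P)} :
    x ∈ FastPathsShallow F s ↔ (∀ᶠ t in atBot, HasDerivAt x (-(gradient F (x t))) t) ∧
      Tendsto x atBot (𝓝 0) ∧ x =O[atBot] fun t => Real.exp (s * t) := by
  unfold FastPathsShallow IsEscapePath
  rw [Set.mem_ofPred_eq, and_assoc, isBigO_norm_left]
  refine and_congr_left fun _ => ?_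
  rw [eventually_atBot]
  constructor
  · rintro ⟨T, hT⟩
    exact ⟨T - 1, fun t ht => hT t (by linarith)⟩
  · rintro ⟨T, hT⟩
    exact ⟨T, fun t ht => hT t ht.le⟩

theorem fast_congr {P : ℕ} {F : EuclideanSpace ℝ (Fin P) → ℝ} {s : ℝ}
    {x y : ℝ → EuclideanSpace ℝ (Fin P)} (hxy : x =ᶠ[atBot] y)
    (hx : x ∈ FastPathsShallow F s) : y ∈ FastPathsShallow F s := by
  rw [fast_iff] at hx ⊢
  obtain ⟨h1, h2, h3⟩ := hx
  refine ⟨?_, h2.congr' hxy, h3.congr' hxy EventuallyEq.rfl⟩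
  obtain ⟨T, hT⟩ := eventually_atBot.1 hxy
  filter_upwards [h1, eventually_lt_atBot T] with t ht htT
  rw [← hT t htT.le]
  refine ht.congr_of_eventuallyEq ?_
  filter_upwards [gt_mem_nhds htT] with r hr using (hT r hr.le).symm

theorem lemX {P m : ℕ} (hm : 2 < m) {s K : ℝ} (hs : 0 < s) (hK : 0 ≤ K)
    (hμ : K < ((m : ℝ) - 1) * s)
    {F₁ F₂ : EuclideanSpace ℝ (Fin P) → ℝ} {W ρ : EuclideanSpace ℝ (Fin P) → EuclideanSpace ℝ (Fin P)}
    (hVW : (fun x => -(gradient F₂ x)) =ᶠ[𝓝 0] W)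
    (hW : ∀ u v, ‖W u - W v‖ ≤ K * ‖u - v‖)
    (hρ : Continuous ρ) (hρO : ρ =O[𝓝 0] fun x => ‖x‖ ^ (m - 1))
    (hF : ∀ x, -(gradient F₁ x) = -(gradient F₂ x) + ρ x)
    {x : ℝ → EuclideanSpace ℝ (Fin P)} (hx : x ∈ FastPathsShallow F₁ s) :
    ∃ y ∈ FastPathsShallow F₂ s,
      (fun t => x t - y t) =O[atBot] fun t => Real.exp (((m : ℝ) - 1) * s * t) := by
  obtain ⟨h1, h2, h3⟩ := fast_iff.1 hx
  have hm' : (2 : ℝ) ≤ (m : ℝ) - 1 := by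
    have : (3 : ℝ) ≤ m := by exact_mod_cast hm
    linarith
  have hr : (fun t => ρ (x t)) =O[atBot] fun t => Real.exp (((m : ℝ) - 1) * s * t) := by
    have h4 := hρO.comp_tendsto h2
    have h5 := h3.norm_left.pow (m - 1)
    refine (h4.trans h5).congr_right fun t => ?_
    rw [← Real.exp_nat_mul, Nat.cast_sub (by omega)]
    congr 1; push_cast; ring
  obtain ⟨y, hy, hxy⟩ := lemB hK hμ hVW hW hρ h2
    (by filter_upwards [h1] with t ht; rw [← hF]; exact ht) hr
  refine ⟨y, ?_, hxy⟩
  have h6 : (fun t => Real.exp (((m : ℝ) - 1) * s * t)) =O[atBot] fun t => Real.exp (s * t) := by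
    refine IsBigO.of_bound 1 ?_
    filter_upwards [eventually_le_atBot 0] with t ht
    rw [one_mul, Real.norm_eq_abs, Real.norm_eq_abs, Real.abs_exp, Real.abs_exp, Real.exp_le_exp]
    nlinarith [mul_nonneg hs.le (neg_nonneg.2 ht)]
  have h7 : y =O[atBot] fun t => Real.exp (s * t) :=
    (h3.sub (hxy.trans h6)).congr_left fun t => by simp
  exact fast_iff.2 ⟨hy, h7.trans_tendsto (aux_exp_atBot hs), h7⟩

/-- **Bijection between fast escaping paths, shallow case (`k = 2`).**
Let `C = H + e` be a `(2,m)`-approximately homogeneous cost with `H` a 2-homogeneous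
polynomial. For every `s₀ > 2‖H‖_∞/(m-1)` there is a unique (up to eventual equality at
`-∞`) bijection `Ψ : 𝓕_H(s₀) → 𝓕_C(s₀)` with
`‖x(t) - Ψ(x)(t)‖ = O(e^{(m-1) s₀ t})` as `t → -∞` for every `x ∈ 𝓕_H(s₀)`. -/
theorem bijection_fast_escape_paths_shallow
    (P m : ℕ) (hm : 2 < m)
    (H e C : EuclideanSpace ℝ (Fin P) → ℝ)
    (hpoly : ∃ p : MvPolynomial (Fin P) ℝ, ∀ x, H x = MvPolynomial.eval (fun i => x i) p)
    (hhom : ∀ α : ℝ, 0 < α → ∀ θ : EuclideanSpace ℝ (Fin P), H (α • θ) = α ^ 2 * H θ)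
    (hes : ContDiff ℝ (⊤ : ℕ∞) e)
    (hev : ∀ n : ℕ, n ≤ m - 1 → iteratedFDeriv ℝ n e 0 = 0)
    (hC : C = H + e)
    (s₀ : ℝ) (hs₀ : 2 * supSphere H / ((m : ℝ) - 1) < s₀) :
    ∃ Ψ : (ℝ → EuclideanSpace ℝ (Fin P)) → (ℝ → EuclideanSpace ℝ (Fin P)),
      Set.BijOn Ψ (FastPathsShallow H s₀) (FastPathsShallow C s₀) ∧
      (∀ x ∈ FastPathsShallow H s₀,
        (fun t => ‖x t - Ψ x t‖) =O[atBot] fun t => Real.exp (((m : ℝ) - 1) * s₀ * t)) ∧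
      ∀ Ψ' : (ℝ → EuclideanSpace ℝ (Fin P)) → (ℝ → EuclideanSpace ℝ (Fin P)),
        Set.BijOn Ψ' (FastPathsShallow H s₀) (FastPathsShallow C s₀) →
        (∀ x ∈ FastPathsShallow H s₀,
          (fun t => ‖x t - Ψ' x t‖) =O[atBot] fun t => Real.exp (((m : ℝ) - 1) * s₀ * t)) →
        ∀ x ∈ FastPathsShallow H s₀, Ψ' x =ᶠ[atBot] Ψ x := by
  classical
  have hm' : (2 : ℝ) ≤ (m : ℝ) - 1 := by
    have : (3 : ℝ) ≤ m := by exact_mod_cast hm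
    linarith
  obtain ⟨hHs, hS, hHL⟩ := lemH hpoly hhom
  obtain ⟨hNc, hNO, hNs⟩ := lemN hm hes hev
  have hLμ : 2 * supSphere H < ((m : ℝ) - 1) * s₀ := by
    rw [div_lt_iff₀ (by linarith)] at hs₀
    linarith
  have hs : 0 < s₀ := lt_of_le_of_lt (by positivity) hs₀
  have hgC : ∀ x, gradient C x = gradient H x + gradient e x := by
    intro x
    rw [hC]
    unfold gradient
    rw [fderiv_add (hHs.differentiable (by simp) x) (hes.differentiable (by simp) x), map_add]
  obtain ⟨K, hK0, hKμ, W, hVW, hW⟩ := lemV (by positivity) hLμ hHL hNs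
  replace hVW : (fun x => -(gradient C x)) =ᶠ[𝓝 0] W := by
    simpa only [hgC] using hVW
  have hW2 : ∀ u v, ‖-(gradient H u) - -(gradient H v)‖ ≤ 2 * supSphere H * ‖u - v‖ := by
    intro u v
    rw [neg_sub_neg, norm_sub_rev]
    exact hHL u v
  have hfwd : ∀ x ∈ FastPathsShallow H s₀, ∃ y ∈ FastPathsShallow C s₀,
      (fun t => x t - y t) =O[atBot] fun t => Real.exp (((m : ℝ) - 1) * s₀ * t) :=
    fun x hx => lemX hm hs hK0 hKμ hVW hW hNc hNO (fun x => by rw [hgC]; abel) hx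
  have hbwd : ∀ y ∈ FastPathsShallow C s₀, ∃ x ∈ FastPathsShallow H s₀,
      (fun t => y t - x t) =O[atBot] fun t => Real.exp (((m : ℝ) - 1) * s₀ * t) :=
    fun y hy => lemX hm hs (by positivity) hLμ (W := fun x => -(gradient H x)) EventuallyEq.rfl hW2
      (ρ := fun x => -(gradient e x)) hNc.neg hNO.neg_left (fun x => by rw [hgC]; abel) hy
  have huC : ∀ y ∈ FastPathsShallow C s₀, ∀ z ∈ FastPathsShallow C s₀,
      (fun t => y t - z t) =O[atBot] (fun t => Real.exp (((m : ℝ) - 1) * s₀ * t)) →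
      y =ᶠ[atBot] z := by
    intro y hy z hz h
    obtain ⟨a1, a2, -⟩ := fast_iff.1 hy
    obtain ⟨b1, b2, -⟩ := fast_iff.1 hz
    exact lemU hKμ hVW hW a2 b2 a1 b1 h
  have huH : ∀ y ∈ FastPathsShallow H s₀, ∀ z ∈ FastPathsShallow H s₀,
      (fun t => y t - z t) =O[atBot] (fun t => Real.exp (((m : ℝ) - 1) * s₀ * t)) →
      y =ᶠ[atBot] z := by
    intro y hy z hz h
    obtain ⟨a1, a2, -⟩ := fast_iff.1 hy
    obtain ⟨b1, b2, -⟩ := fast_iff.1 hz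
    exact lemU hLμ (V := fun x => -(gradient H x)) EventuallyEq.rfl hW2 a2 b2 a1 b1 h
  choose! φ hφ hφO using hfwd
  -- canonical representatives of germs at `-∞`
  obtain ⟨rep, hrep, hrep'⟩ : ∃ rep : (ℝ → EuclideanSpace ℝ (Fin P)) →
      (ℝ → EuclideanSpace ℝ (Fin P)), (∀ x, rep x =ᶠ[atBot] x) ∧
      ∀ x y, x =ᶠ[atBot] y → rep x = rep y := by
    refine ⟨fun x => Quotient.out (s := Filter.germSetoid atBot _) (Quotient.mk _ x),
      fun x => ?_, fun x y h => ?_⟩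
    · exact Quotient.mk_out (s := Filter.germSetoid atBot _) x
    · exact congrArg _ (Quotient.sound (s := Filter.germSetoid atBot _) h)
  let Ψ : (ℝ → EuclideanSpace ℝ (Fin P)) → (ℝ → EuclideanSpace ℝ (Fin P)) :=
    fun x => x - rep x + φ (rep x)
  have hΨe : ∀ x, Ψ x =ᶠ[atBot] φ (rep x) := by
    intro x
    filter_upwards [hrep x] with t ht
    simp [Ψ, ht]
  have hrm : ∀ x ∈ FastPathsShallow H s₀, rep x ∈ FastPathsShallow H s₀ := fun x hx =>
    fast_congr (hrep x).symm hx
  have hΨm : ∀ x ∈ FastPathsShallow H s₀, Ψ x ∈ FastPathsShallow C s₀ := fun x hx =>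
    fast_congr (hΨe x).symm (hφ _ (hrm x hx))
  have hΨO : ∀ x ∈ FastPathsShallow H s₀, (fun t => x t - Ψ x t) =O[atBot]
      fun t => Real.exp (((m : ℝ) - 1) * s₀ * t) := by
    intro x hx
    refine (hφO _ (hrm x hx)).congr' ?_ EventuallyEq.rfl
    filter_upwards [hΨe x, hrep x] with t h1 h2
    rw [h1, h2]
  refine ⟨Ψ, ⟨hΨm, ?_, ?_⟩, fun x hx => (hΨO x hx).norm_left, ?_⟩
  · intro x hx x' hx' h
    have h1 : x =ᶠ[atBot] x' := by
      refine huH x hx x' hx' (((hΨO x hx).sub (hΨO x' hx')).congr_left fun t => ?_)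
      rw [h]; abel
    have h2 := hrep' x x' h1
    simp only [Ψ, h2] at h
    exact sub_left_inj.1 (add_left_injective _ h)
  · intro y hy
    obtain ⟨x₀, hx₀, hO⟩ := hbwd y hy
    have hr := hrm x₀ hx₀
    have h1 : φ (rep x₀) =ᶠ[atBot] y := by
      refine huC _ (hφ _ hr) _ hy ?_
      have h2 : (fun t => y t - rep x₀ t) =O[atBot]
          fun t => Real.exp (((m : ℝ) - 1) * s₀ * t) := by
        refine hO.congr' ?_ EventuallyEq.rfl
        filter_upwards [hrep x₀] with t ht
        rw [ht]
      exact ((hφO _ hr).add h2).neg_left.congr_left fun t => by abel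
    have h3 : y - φ (rep x₀) + rep x₀ =ᶠ[atBot] x₀ := by
      filter_upwards [h1, hrep x₀] with t ht ht'
      simp [ht, ht']
    refine ⟨y - φ (rep x₀) + rep x₀, fast_congr h3.symm hx₀, ?_⟩
    simp only [Ψ, hrep' _ _ h3]
    abel
  · intro Ψ' hb hO x hx
    refine huC _ (hb.mapsTo hx) _ (hΨm x hx) ?_
    have h1 : (fun t => x t - Ψ' x t) =O[atBot]
        fun t => Real.exp (((m : ℝ) - 1) * s₀ * t) := (hO x hx).of_norm_left
    exact ((hΨO x hx).sub h1).congr_left fun t => by abel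
end
end
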